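/- Let s ≥ 1/2. There exist constants c > 0 and β > 0 such that for every v₀ : ℤ → ℂ with ‖v₀‖_{H^s} < ∞ and v₀(−k) = conj(v₀(k)) for all k ∈ ℤ, there exist a time T ≥ c (1 + ‖v₀‖_{H^s})^{−β} and a solution v of (∗) on [0,T] in C([0,T];H^s) with v(0) = v₀ (local existence for periodic mKdV in H^s). -/

import Mathlib

open scoped ENNReal

/-- Japanese bracket `⟨k⟩ = 1 + |k|`. -/
noncomputable def jb (k : ℤ) : ℝ := 1 + |(k : ℝ)|

/-- `‖f‖_{H^s} = (∑_k ⟨k⟩^{2s} |f k|²)^{1/2}`, valued in `[0,∞]`. -/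
noncomputable def hnorm (s : ℝ) (f : ℤ → ℂ) : ℝ≥0∞ :=
  (∑' k : ℤ, ENNReal.ofReal (jb k ^ (2 * s) * ‖f k‖ ^ 2)) ^ (1 / 2 : ℝ)

/-- `Φ(k̄) = k³ − k₁³ − k₂³ − k₃³` with `k = k₁ + k₂ + k₃`. -/
def Phi (k₁ k₂ k₃ : ℤ) : ℤ := (k₁ + k₂ + k₃) ^ 3 - k₁ ^ 3 - k₂ ^ 3 - k₃ ^ 3

/-- Summand of the non-resonant part, parametrized by `(k₁, k₂)` with `k₃ = k - k₁ - k₂`. -/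
noncomputable def ntermF (v : ℤ → ℂ) (t : ℝ) (k : ℤ) (p : ℤ × ℤ) : ℂ :=
  if Phi p.1 p.2 (k - p.1 - p.2) ≠ 0 then
    (k : ℂ) * Complex.exp (Complex.I * (t : ℂ) * ((Phi p.1 p.2 (k - p.1 - p.2) : ℤ) : ℂ)) *
      v p.1 * v p.2 * v (k - p.1 - p.2)
  else 0

/-- Non-resonant part `N(v)(t)_k`. -/
noncomputable def Nonres (v : ℤ → ℂ) (t : ℝ) (k : ℤ) : ℂ :=
  Complex.I / 3 * ∑' p : ℤ × ℤ, ntermF v t k p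

/-- Resonant part `R(v)_k = -i k |v_k|² v_k`. -/
noncomputable def Res (v : ℤ → ℂ) (k : ℤ) : ℂ :=
  -Complex.I * (k : ℂ) * (‖v k‖ : ℂ) ^ 2 * v k

/-- `v` is a solution of the renormalized mKdV system (∗) on `[0,T]` in `C([0,T];H^s)`. -/
structure IsSolution (s T : ℝ) (v : ℝ → ℤ → ℂ) : Prop where
  finite : ∀ t ∈ Set.Icc (0 : ℝ) T, hnorm s (v t) < ⊤
  cont : ∀ t ∈ Set.Icc (0 : ℝ) T, ∀ ε > (0 : ℝ), ∃ δ > (0 : ℝ),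
    ∀ t' ∈ Set.Icc (0 : ℝ) T, |t' - t| < δ →
      hnorm s (fun k => v t' k - v t k) < ENNReal.ofReal ε
  abs_summable : ∀ t ∈ Set.Icc (0 : ℝ) T, ∀ k : ℤ,
    Summable (fun p : ℤ × ℤ => ‖ntermF (v t) t k p‖)
  eqn : ∀ t ∈ Set.Icc (0 : ℝ) T, ∀ k : ℤ,
    HasDerivWithinAt (fun τ => v τ k) (Nonres (v t) t k + Res (v t) k) (Set.Icc (0 : ℝ) T) t

lemma one_le_jb (k : ℤ) : 1 ≤ jb k := by unfold jb; linarith [abs_nonneg (k : ℝ)]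

lemma jb_pos (k : ℤ) : 0 < jb k := one_pos.trans_le (one_le_jb k)

@[simp] lemma jb_neg (k : ℤ) : jb (-k) = jb k := by simp [jb]

lemma abs_le_jb (k : ℤ) : |(k : ℝ)| ≤ jb k := by unfold jb; linarith

lemma jb_add_le (a b : ℤ) : jb (a + b) ≤ jb a * jb b := by
  unfold jb
  push_cast
  nlinarith [abs_add_le (a : ℝ) b, mul_nonneg (abs_nonneg (a : ℝ)) (abs_nonneg (b : ℝ))]

lemma summable_jb_rpow_neg {p : ℝ} (hp : 1 < p) : Summable fun k : ℤ => jb k ^ (-p) := by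
  have h0 : Summable fun n : ℕ => ((n : ℝ) + 1) ^ (-p) := by
    have := (summable_nat_add_iff 1).2 (Real.summable_nat_rpow.2 (by linarith : -p < -1))
    simpa using this
  refine Summable.of_nat_of_neg ?_ ?_
  · simpa [jb, add_comm] using h0
  · simpa [jb, add_comm] using h0

/-- The Cauchy–Schwarz inequality for sums in `[0,∞]`. -/
lemma ENNReal.tsum_mul_sq_le {ι : Type*} (f g : ι → ℝ≥0∞) :
    (∑' i, f i * g i) ^ 2 ≤ (∑' i, f i ^ 2) * ∑' i, g i ^ 2 := by
  have key : ∀ s : Finset ι,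
      ∑ i ∈ s, f i * g i ≤ ((∑' i, f i ^ 2) * ∑' i, g i ^ 2) ^ (1 / 2 : ℝ) := by
    intro s
    have h := ENNReal.inner_le_Lp_mul_Lq s f g (p := 2) (q := 2) Real.HolderConjugate.two_two
    refine h.trans ?_
    rw [ENNReal.mul_rpow_of_nonneg _ _ (by norm_num)]
    gcongr
    · simpa using ENNReal.sum_le_tsum s (f := fun i => f i ^ 2)
    · simpa using ENNReal.sum_le_tsum s (f := fun i => g i ^ 2)
  have h2 : ∑' i, f i * g i ≤ ((∑' i, f i ^ 2) * ∑' i, g i ^ 2) ^ (1 / 2 : ℝ) := by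
    rw [ENNReal.tsum_eq_iSup_sum]
    exact iSup_le key
  calc (∑' i, f i * g i) ^ 2 ≤ (((∑' i, f i ^ 2) * ∑' i, g i ^ 2) ^ (1 / 2 : ℝ)) ^ 2 := by gcongr
    _ = _ := by
      rw [← ENNReal.rpow_natCast, ← ENNReal.rpow_mul]
      norm_num

/-- The trilinear convolution `(f * f * f)(k)`. -/
noncomputable def conv3 (f : ℤ → ℝ≥0∞) (k : ℤ) : ℝ≥0∞ :=
  ∑' p : ℤ × ℤ, f p.1 * f p.2 * f (k - p.1 - p.2)

lemma conv3_mono {f g : ℤ → ℝ≥0∞} (h : ∀ k, f k ≤ g k) (k : ℤ) : conv3 f k ≤ conv3 g k := by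
  unfold conv3
  gcongr <;> exact h _

lemma tsum_conv3 (f : ℤ → ℝ≥0∞) : ∑' k, conv3 f k = (∑' k, f k) ^ 3 := by
  unfold conv3
  rw [ENNReal.tsum_comm]
  have : ∀ p : ℤ × ℤ, ∑' k, f p.1 * f p.2 * f (k - p.1 - p.2) = f p.1 * f p.2 * ∑' k, f k := by
    intro p
    rw [ENNReal.tsum_mul_left]
    congr 1
    have := (Equiv.subRight (p.1 + p.2)).tsum_eq f
    simpa [sub_sub] using this
  simp_rw [this]
  rw [ENNReal.tsum_mul_right, ENNReal.tsum_prod']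
  simp_rw [ENNReal.tsum_mul_left, ENNReal.tsum_mul_right]
  ring

lemma three_prod_le {x y z : ℝ} (hx : 1 ≤ x) (hy : 1 ≤ y) (hz : 1 ≤ z) :
    x ^ (-(5 / 6 : ℝ)) * y ^ (-(5 / 6 : ℝ)) * z ^ (-(5 / 6 : ℝ)) ≤
      x ^ (-(5 / 4 : ℝ)) * y ^ (-(5 / 4 : ℝ)) + y ^ (-(5 / 4 : ℝ)) * z ^ (-(5 / 4 : ℝ)) +
        x ^ (-(5 / 4 : ℝ)) * z ^ (-(5 / 4 : ℝ)) := by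
  have key : ∀ a b c : ℝ, 1 ≤ a → 1 ≤ b → a ≤ c → b ≤ c →
      a ^ (-(5 / 6 : ℝ)) * b ^ (-(5 / 6 : ℝ)) * c ^ (-(5 / 6 : ℝ)) ≤
        a ^ (-(5 / 4 : ℝ)) * b ^ (-(5 / 4 : ℝ)) := by
    intro a b c ha hb hac hbc
    have ha0 : 0 < a := by linarith
    have hb0 : 0 < b := by linarith
    have hc0 : 0 < c := by linarith
    have e : c ^ (-(5 / 6 : ℝ)) ≤ a ^ (-(5 / 12 : ℝ)) * b ^ (-(5 / 12 : ℝ)) := by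
      have : c ^ (-(5 / 6 : ℝ)) = c ^ (-(5 / 12 : ℝ)) * c ^ (-(5 / 12 : ℝ)) := by
        rw [← Real.rpow_add hc0]; norm_num
      rw [this]
      exact mul_le_mul (Real.rpow_le_rpow_of_nonpos ha0 hac (by norm_num))
        (Real.rpow_le_rpow_of_nonpos hb0 hbc (by norm_num)) (by positivity) (by positivity)
    calc _ ≤ a ^ (-(5 / 6 : ℝ)) * b ^ (-(5 / 6 : ℝ)) *
          (a ^ (-(5 / 12 : ℝ)) * b ^ (-(5 / 12 : ℝ))) := by gcongr
      _ = (a ^ (-(5 / 6 : ℝ)) * a ^ (-(5 / 12 : ℝ))) *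
          (b ^ (-(5 / 6 : ℝ)) * b ^ (-(5 / 12 : ℝ))) := by ring
      _ = _ := by rw [← Real.rpow_add ha0, ← Real.rpow_add hb0]; norm_num
  have px : 0 < x ^ (-(5 / 4 : ℝ)) := Real.rpow_pos_of_pos (by linarith) _
  have py : 0 < y ^ (-(5 / 4 : ℝ)) := Real.rpow_pos_of_pos (by linarith) _
  have pz : 0 < z ^ (-(5 / 4 : ℝ)) := Real.rpow_pos_of_pos (by linarith) _
  have pxy := mul_pos px py
  have pyz := mul_pos py pz
  have pxz := mul_pos px pz
  rcases le_total x y with h1 | h1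
  · rcases le_total y z with h2 | h2
    · linarith [key x y z hx hy (h1.trans h2) h2]
    · linarith [key x z y hx hz h1 h2]
  · rcases le_total x z with h2 | h2
    · linarith [key x y z hx hy h2 (h1.trans h2)]
    · linarith [key y z x hy hz h1 h2]

lemma exists_conv3_weight_bound : ∃ C : ℝ, 0 ≤ C ∧ ∀ k : ℤ,
    conv3 (fun j => ENNReal.ofReal (jb j ^ (-(5 / 6 : ℝ)))) k ≤ ENNReal.ofReal C := by
  set Z : ℝ≥0∞ := ∑' j : ℤ, ENNReal.ofReal (jb j ^ (-(5 / 4 : ℝ))) with hZ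
  have hZf : Z ≠ ⊤ := (summable_jb_rpow_neg (by norm_num : (1 : ℝ) < 5 / 4)).tsum_ofReal_ne_top
  refine ⟨(3 * Z ^ 2).toReal, ENNReal.toReal_nonneg, fun k => ?_⟩
  rw [ENNReal.ofReal_toReal (by finiteness)]
  set u : ℤ → ℝ≥0∞ := fun j => ENNReal.ofReal (jb j ^ (-(5 / 4 : ℝ))) with hu
  have hp : ∀ (j : ℤ) (r : ℝ), 0 ≤ jb j ^ r := fun j r => Real.rpow_nonneg (jb_pos j).le _
  have h1 : conv3 (fun j => ENNReal.ofReal (jb j ^ (-(5 / 6 : ℝ)))) k ≤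
      ∑' p : ℤ × ℤ, (u p.1 * u p.2 + u p.2 * u (k - p.1 - p.2) + u p.1 * u (k - p.1 - p.2)) := by
    unfold conv3
    refine ENNReal.tsum_le_tsum fun p => ?_
    simp only [hu]
    rw [← ENNReal.ofReal_mul (hp _ _), ← ENNReal.ofReal_mul (mul_nonneg (hp _ _) (hp _ _)),
      ← ENNReal.ofReal_mul (hp _ _), ← ENNReal.ofReal_mul (hp _ _), ← ENNReal.ofReal_mul (hp _ _),
      ← ENNReal.ofReal_add (mul_nonneg (hp _ _) (hp _ _)) (mul_nonneg (hp _ _) (hp _ _)),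
      ← ENNReal.ofReal_add (add_nonneg (mul_nonneg (hp _ _) (hp _ _))
        (mul_nonneg (hp _ _) (hp _ _))) (mul_nonneg (hp _ _) (hp _ _))]
    exact ENNReal.ofReal_le_ofReal (three_prod_le (one_le_jb _) (one_le_jb _) (one_le_jb _))
  refine h1.trans ?_
  have shift : ∀ a : ℤ, ∑' j : ℤ, u (a - j) = Z := fun a => (Equiv.subLeft a).tsum_eq u
  have e1 : ∑' p : ℤ × ℤ, u p.1 * u p.2 = Z * Z := by
    rw [ENNReal.tsum_prod']
    simp_rw [ENNReal.tsum_mul_left, ENNReal.tsum_mul_right]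
    rfl
  have e2 : ∑' p : ℤ × ℤ, u p.1 * u (k - p.1 - p.2) = Z * Z := by
    rw [ENNReal.tsum_prod']
    simp_rw [ENNReal.tsum_mul_left, shift, ENNReal.tsum_mul_right]
    rfl
  have e3 : ∑' p : ℤ × ℤ, u p.2 * u (k - p.1 - p.2) = Z * Z := by
    rw [ENNReal.tsum_prod', ENNReal.tsum_comm]
    simp_rw [ENNReal.tsum_mul_left, sub_right_comm k, shift, ENNReal.tsum_mul_right]
    rfl
  rw [ENNReal.tsum_add, ENNReal.tsum_add, e1, e2, e3]
  ring_nf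
  rfl

/-- Square of the `H^s` norm. -/
noncomputable def sob (s : ℝ) (f : ℤ → ℂ) : ℝ≥0∞ :=
  ∑' k : ℤ, ENNReal.ofReal (jb k ^ (2 * s) * ‖f k‖ ^ 2)

lemma hnorm_eq (s : ℝ) (f : ℤ → ℂ) : hnorm s f = sob s f ^ (1 / 2 : ℝ) := rfl

/-- The sequence `⟨k⟩^{s-5/12} |f k|`. -/
noncomputable def envl (s : ℝ) (f : ℤ → ℂ) (k : ℤ) : ℝ≥0∞ :=
  ENNReal.ofReal (jb k ^ (s - 5 / 12) * ‖f k‖)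

lemma weight_mul_envl_sq (s : ℝ) (f : ℤ → ℂ) (k : ℤ) :
    ENNReal.ofReal (jb k ^ (5 / 6 : ℝ)) * envl s f k ^ 2 =
      ENNReal.ofReal (jb k ^ (2 * s) * ‖f k‖ ^ 2) := by
  have hj := jb_pos k
  unfold envl
  rw [← ENNReal.ofReal_pow (by positivity), ← ENNReal.ofReal_mul (by positivity)]
  congr 1
  rw [mul_pow, ← mul_assoc, ← Real.rpow_natCast (jb k ^ _), ← Real.rpow_mul hj.le,
    ← Real.rpow_add hj]
  congr 2
  push_cast
  ring

lemma tsum_envl_sq_le (s : ℝ) (f : ℤ → ℂ) : ∑' k, envl s f k ^ 2 ≤ sob s f := by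
  refine ENNReal.tsum_le_tsum fun k => ?_
  rw [← weight_mul_envl_sq]
  refine le_mul_of_one_le_left zero_le ?_
  rw [← ENNReal.ofReal_one]
  exact ENNReal.ofReal_le_ofReal (Real.one_le_rpow (one_le_jb k) (by norm_num))

lemma exists_conv3_envl_bound : ∃ C : ℝ, 0 ≤ C ∧ ∀ (s : ℝ) (f : ℤ → ℂ),
    ∑' k, conv3 (envl s f) k ^ 2 ≤ ENNReal.ofReal C * sob s f ^ 3 := by
  obtain ⟨C, hC, hb⟩ := exists_conv3_weight_bound
  refine ⟨C, hC, fun s f => ?_⟩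
  set a : ℤ → ℝ≥0∞ := fun j => ENNReal.ofReal (jb j ^ (5 / 12 : ℝ)) * envl s f j with ha
  set b : ℤ → ℝ≥0∞ := fun j => ENNReal.ofReal (jb j ^ (-(5 / 12 : ℝ))) with hbd
  have hab : ∀ j, envl s f j = b j * a j := by
    intro j
    have hj := jb_pos j
    simp only [ha, hbd]
    rw [← mul_assoc, ← ENNReal.ofReal_mul (by positivity), ← Real.rpow_add hj]
    norm_num
  have ha2 : ∀ j, a j ^ 2 = ENNReal.ofReal (jb j ^ (2 * s) * ‖f j‖ ^ 2) := by
    intro j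
    have hj := jb_pos j
    rw [← weight_mul_envl_sq, ha, mul_pow, ← ENNReal.ofReal_pow (by positivity),
      ← Real.rpow_natCast, ← Real.rpow_mul hj.le]
    norm_num
  have hb2 : ∀ j, b j ^ 2 = ENNReal.ofReal (jb j ^ (-(5 / 6 : ℝ))) := by
    intro j
    have hj := jb_pos j
    rw [hbd, ← ENNReal.ofReal_pow (by positivity), ← Real.rpow_natCast, ← Real.rpow_mul hj.le]
    norm_num
  have h1 : ∀ k, conv3 (envl s f) k ^ 2 ≤
      ENNReal.ofReal C * conv3 (fun j => a j ^ 2) k := by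
    intro k
    have e : conv3 (envl s f) k = ∑' p : ℤ × ℤ, (b p.1 * b p.2 * b (k - p.1 - p.2)) *
        (a p.1 * a p.2 * a (k - p.1 - p.2)) := by
      unfold conv3
      refine tsum_congr fun p => ?_
      rw [hab, hab, hab]
      ring
    rw [e]
    refine (ENNReal.tsum_mul_sq_le _ _).trans ?_
    have := hb k
    unfold conv3 at *
    simp_rw [mul_pow, hb2]
    gcongr
  calc _ ≤ ∑' k, ENNReal.ofReal C * conv3 (fun j => a j ^ 2) k := ENNReal.tsum_le_tsum h1
    _ = _ := by
      rw [ENNReal.tsum_mul_left, tsum_conv3]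
      simp_rw [ha2]
      rfl

/-- The smooth frequency cutoff power `(x - K)_+ ^ p`. -/
noncomputable def cutPow (p K x : ℝ) : ℝ := max (x - K) 0 ^ p

lemma hasDerivAt_max_rpow {p : ℝ} (hp : 1 < p) (x : ℝ) :
    HasDerivAt (fun y : ℝ => max y 0 ^ p) (p * max x 0 ^ (p - 1)) x := by
  rcases lt_trichotomy x 0 with hx | hx | hx
  · have h : (fun y : ℝ => max y 0 ^ p) =ᶠ[nhds x] fun _ => (0 : ℝ) := by
      filter_upwards [Iio_mem_nhds hx] with y hy
      rw [max_eq_right (le_of_lt hy), Real.zero_rpow (by linarith)]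
    rw [max_eq_right hx.le, Real.zero_rpow (by linarith), mul_zero]
    exact (hasDerivAt_const x (0 : ℝ)).congr_of_eventuallyEq h
  · subst hx
    have h0 := Real.hasDerivAt_rpow_const (x := 0) (p := p) (Or.inr hp.le)
    rw [Real.zero_rpow (by linarith : p - 1 ≠ 0), mul_zero] at h0
    rw [max_self, Real.zero_rpow (by linarith : p - 1 ≠ 0), mul_zero]
    have hl : HasDerivWithinAt (fun y : ℝ => max y 0 ^ p) 0 (Set.Iic 0) 0 := by
      refine (hasDerivWithinAt_const (0 : ℝ) (Set.Iic 0) (0 : ℝ)).congr ?_ ?_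
      · intro y hy
        rw [max_eq_right hy, Real.zero_rpow (by linarith)]
      · rw [max_self, Real.zero_rpow (by linarith)]
    have hr : HasDerivWithinAt (fun y : ℝ => max y 0 ^ p) 0 (Set.Ici 0) 0 := by
      refine (h0.hasDerivWithinAt (s := Set.Ici 0)).congr ?_ ?_
      · intro y hy
        rw [max_eq_left hy]
      · rw [max_self]
    have := hl.union hr
    rwa [Set.Iic_union_Ici, hasDerivWithinAt_univ] at this
  · have h : (fun y : ℝ => max y 0 ^ p) =ᶠ[nhds x] fun y => y ^ p := by
      filter_upwards [Ioi_mem_nhds hx] with y hy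
      rw [max_eq_left (le_of_lt hy)]
    rw [max_eq_left hx.le]
    exact (Real.hasDerivAt_rpow_const (Or.inl hx.ne')).congr_of_eventuallyEq h

lemma hasDerivAt_cutPow {p : ℝ} (hp : 1 < p) (K x : ℝ) :
    HasDerivAt (cutPow p K) (p * max (x - K) 0 ^ (p - 1)) x := by
  have := (hasDerivAt_max_rpow hp (x - K)).comp x ((hasDerivAt_id x).sub_const K)
  simpa using! this

lemma abs_rpow_sub_rpow_le {q N x y : ℝ} (hq : 1 ≤ q) (hx : x ∈ Set.Icc 0 N)
    (hy : y ∈ Set.Icc 0 N) : |y ^ q - x ^ q| ≤ q * N ^ (q - 1) * |y - x| := by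
  refine (convex_Icc (0 : ℝ) N).norm_image_sub_le_of_norm_hasDerivWithin_le
    (f := fun z : ℝ => z ^ q) (f' := fun z => q * z ^ (q - 1)) ?_ ?_ hx hy
  · intro z _
    exact (Real.hasDerivAt_rpow_const (Or.inr hq)).hasDerivWithinAt
  · intro z hz
    have : 0 ≤ z ^ (q - 1) := Real.rpow_nonneg hz.1 _
    rw [Real.norm_of_nonneg (by positivity)]
    gcongr
    · exact hz.1
    · exact hz.2

lemma cutPow_second_difference {p K N x a b : ℝ} (hp : 2 ≤ p) (hK : 0 ≤ K) (hN : 0 ≤ N)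
    (h1 : |x| ≤ N) (h2 : |x + a| ≤ N) (h3 : |x + b| ≤ N) (h4 : |x + a + b| ≤ N) :
    |cutPow p K (x + a + b) - cutPow p K (x + a) - cutPow p K (x + b) + cutPow p K x| ≤
      p * (p - 1) * N ^ (p - 2) * |a| * |b| := by
  have hcl : ∀ z, |z| ≤ N → max (z - K) 0 ∈ Set.Icc 0 N := by
    intro z hz
    refine ⟨le_max_right _ _, max_le ?_ hN⟩
    linarith [le_abs_self z]
  have hmain := (convex_uIcc x (x + a)).norm_image_sub_le_of_norm_hasDerivWithin_le
    (f := fun z => cutPow p K (z + b) - cutPow p K z)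
    (f' := fun z => p * max (z + b - K) 0 ^ (p - 1) - p * max (z - K) 0 ^ (p - 1))
    (C := p * (p - 1) * N ^ (p - 2) * |b|) (x := x) (y := x + a) ?_ ?_
    Set.left_mem_uIcc Set.right_mem_uIcc
  · simp only [Real.norm_eq_abs, add_sub_cancel_left] at hmain
    calc _ = |cutPow p K (x + a + b) - cutPow p K (x + a) -
          (cutPow p K (x + b) - cutPow p K x)| := by congr 1; ring
      _ ≤ _ := hmain
      _ = _ := by ring
  · intro z _
    refine HasDerivAt.hasDerivWithinAt ?_
    refine HasDerivAt.sub ?_ (hasDerivAt_cutPow (by linarith) K z)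
    exact (hasDerivAt_cutPow (by linarith) K (z + b)).comp_add_const z b
  · intro z hz
    have hsub : Set.uIcc x (x + a) ⊆ Set.Icc (-N) N :=
      (Set.ordConnected_Icc).uIcc_subset (abs_le.1 h1) (abs_le.1 h2)
    have hzN : |z| ≤ N := abs_le.2 (hsub hz)
    have hsub' : Set.uIcc (x + b) (x + a + b) ⊆ Set.Icc (-N) N :=
      (Set.ordConnected_Icc).uIcc_subset (abs_le.1 h3) (abs_le.1 h4)
    have hz' : z + b ∈ Set.uIcc (x + b) (x + a + b) := by
      rw [Set.mem_uIcc] at hz ⊢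
      rcases hz with h | h
      · left; constructor <;> linarith [h.1, h.2]
      · right; constructor <;> linarith [h.1, h.2]
    have hzbN : |z + b| ≤ N := abs_le.2 (hsub' hz')
    rw [← mul_sub, Real.norm_eq_abs, abs_mul, abs_of_nonneg (by linarith : 0 ≤ p)]
    have hl := abs_rpow_sub_rpow_le (q := p - 1) (by linarith) (hcl z hzN) (hcl _ hzbN)
    have hm : |max (z + b - K) 0 - max (z - K) 0| ≤ |b| := by
      have := abs_max_sub_max_le_abs (z + b - K) (z - K) 0
      simpa using! this.trans_eq (by congr 1; ring)
    have e : p - 1 - 1 = p - 2 := by ring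
    rw [e] at hl
    have hp1 : 0 ≤ p - 1 := by linarith
    have hp0 : 0 ≤ p := by linarith
    calc p * |max (z + b - K) 0 ^ (p - 1) - max (z - K) 0 ^ (p - 1)|
        ≤ p * ((p - 1) * N ^ (p - 2) * |max (z + b - K) 0 - max (z - K) 0|) := by gcongr
      _ ≤ p * ((p - 1) * N ^ (p - 2) * |b|) := by gcongr
      _ = _ := by ring

/-- The odd function `sgn(x) (|x| - K)_+ ^ p`. -/
noncomputable def oddCut (p K x : ℝ) : ℝ := cutPow p K x - cutPow p K (-x)

lemma oddCut_neg (p K x : ℝ) : oddCut p K (-x) = -oddCut p K x := by simp [oddCut]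

lemma oddCut_of_abs_le {p K x : ℝ} (hx : |x| ≤ K) : oddCut p K x = 0 := by
  obtain ⟨h1, h2⟩ := abs_le.1 hx
  simp only [oddCut, cutPow]
  rw [max_eq_right (by linarith), max_eq_right (by linarith), sub_self]

lemma oddCut_of_nonneg {p K x : ℝ} (hp : 0 < p) (hK : 0 ≤ K) (hx : 0 ≤ x) :
    oddCut p K x = max (x - K) 0 ^ p := by
  simp only [oddCut, cutPow]
  rw [max_eq_right (by linarith : -x - K ≤ 0), Real.zero_rpow hp.ne', sub_zero]

lemma oddCut_second_difference {p K N x a b : ℝ} (hp : 2 ≤ p) (hK : 0 ≤ K) (hN : 0 ≤ N)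
    (h1 : |x| ≤ N) (h2 : |x + a| ≤ N) (h3 : |x + b| ≤ N) (h4 : |x + a + b| ≤ N) :
    |oddCut p K (x + a + b) - oddCut p K (x + a) - oddCut p K (x + b) + oddCut p K x| ≤
      2 * (p * (p - 1) * N ^ (p - 2) * |a| * |b|) := by
  have e1 := cutPow_second_difference hp hK hN h1 h2 h3 h4
  have e2 := cutPow_second_difference (x := -x) (a := -a) (b := -b) hp hK hN
    (by rwa [abs_neg]) (by rwa [← neg_add, abs_neg]) (by rwa [← neg_add, abs_neg])
    (by rwa [← neg_add, ← neg_add, abs_neg])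
  rw [abs_neg, abs_neg, ← neg_add, ← neg_add, ← neg_add] at e2
  have := (abs_sub _ _).trans (add_le_add e1 e2)
  refine le_trans (le_of_eq ?_) (this.trans_eq (by ring))
  congr 1
  simp only [oddCut]
  ring

lemma oddCut_sum_le_aux {p K N x y z w : ℝ} (hp : 2 ≤ p) (hK : 0 ≤ K) (hN : 0 < N)
    (hsum : x + y + z + w = 0)
    (hx : |x| ≤ N) (hy : |y| ≤ N) (hz : |z| ≤ N) (hw : |w| ≤ N) (hc : 2 / 3 * N ≤ |x + y|) :
    |oddCut p K x + oddCut p K y + oddCut p K z + oddCut p K w| ≤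
      p * (p - 1) * N ^ (p - 3) * |3 * ((x + y) * (y + z) * (z + x))| := by
  have e := oddCut_second_difference (x := z) (a := -(y + z)) (b := -(z + x)) hp hK hN.le hz
    (by rw [show z + -(y + z) = -y by ring, abs_neg]; exact hy)
    (by rw [show z + -(z + x) = -x by ring, abs_neg]; exact hx)
    (by rw [show z + -(y + z) + -(z + x) = w by linarith]; exact hw)
  rw [show z + -(y + z) = -y by ring, show z + -(z + x) = -x by ring,
    show -y + -(z + x) = w by linarith, oddCut_neg, oddCut_neg, abs_neg, abs_neg] at e
  have hpw : N ^ (p - 2) = N ^ (p - 3) * N := by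
    rw [← Real.rpow_add_one hN.ne']; congr 1; ring
  have hp3 : 0 ≤ N ^ (p - 3) := Real.rpow_nonneg hN.le _
  have hpp : 0 ≤ p * (p - 1) := mul_nonneg (by linarith) (by linarith)
  calc _ = |oddCut p K w - -oddCut p K y - -oddCut p K x + oddCut p K z| := by congr 1; ring
    _ ≤ _ := e
    _ = p * (p - 1) * N ^ (p - 3) * (3 * (2 / 3 * N * |y + z| * |z + x|)) := by rw [hpw]; ring
    _ ≤ p * (p - 1) * N ^ (p - 3) * (3 * (|x + y| * |y + z| * |z + x|)) := by gcongr
    _ = _ := by rw [abs_mul, abs_mul, abs_mul]; norm_num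

/-- The symmetrized weight is controlled by the phase. -/
lemma abs_oddCut_sum_le {p K N x y z w : ℝ} (hp : 2 ≤ p) (hK : 0 ≤ K) (hN : 0 < N)
    (hsum : x + y + z + w = 0)
    (hx : |x| ≤ N) (hy : |y| ≤ N) (hz : |z| ≤ N) (hw : |w| ≤ N)
    (hmax : N = |x| ∨ N = |y| ∨ N = |z| ∨ N = |w|) :
    |oddCut p K x + oddCut p K y + oddCut p K z + oddCut p K w| ≤
      p * (p - 1) * N ^ (p - 3) * |3 * ((x + y) * (y + z) * (z + x))| := by
  have hbig : 2 / 3 * N ≤ |x + y| ∨ 2 / 3 * N ≤ |y + z| ∨ 2 / 3 * N ≤ |z + x| := by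
    by_contra! h
    obtain ⟨h1, h2, h3⟩ := h
    rw [abs_lt] at h1 h2 h3
    have : ∀ u, (u = x ∨ u = y ∨ u = z ∨ u = w) → |u| < N := by
      rintro u (rfl | rfl | rfl | rfl) <;> rw [abs_lt] <;> constructor <;> linarith
    rcases hmax with h | h | h | h
    · exact absurd (this x (by simp)) (by linarith)
    · exact absurd (this y (by simp)) (by linarith)
    · exact absurd (this z (by simp)) (by linarith)
    · exact absurd (this w (by simp)) (by linarith)
  rcases hbig with h | h | h
  · exact oddCut_sum_le_aux hp hK hN hsum hx hy hz hw h
  · have := oddCut_sum_le_aux (p := p) (K := K) hp hK hN (by linarith : y + z + x + w = 0)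
      hy hz hx hw h
    convert this using 2
    · ring
    · congr 1; ring
  · have := oddCut_sum_le_aux (p := p) (K := K) hp hK hN (by linarith : z + x + y + w = 0)
      hz hx hy hw h
    convert this using 2
    · ring
    · congr 1; ring

/-- The frequencies of size at most `n`. -/
noncomputable def freqs (n : ℕ) : Finset ℤ := Finset.Icc (-(n : ℤ)) n

lemma mem_freqs {n : ℕ} {k : ℤ} : k ∈ freqs n ↔ |k| ≤ n := by
  rw [freqs, Finset.mem_Icc, abs_le]

lemma neg_mem_freqs {n : ℕ} {k : ℤ} : -k ∈ freqs n ↔ k ∈ freqs n := by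
  rw [mem_freqs, mem_freqs, abs_neg]

/-- The resonance function on quadruples with zero sum. -/
def qphase (q : Fin 4 → ℤ) : ℤ := -∑ i, q i ^ 3

/-- Nonresonant quadruples of frequencies of size at most `n` with zero sum. -/
noncomputable def nrset (n : ℕ) : Finset (Fin 4 → ℤ) :=
  (Fintype.piFinset fun _ => freqs n).filter fun q => ∑ i, q i = 0 ∧ qphase q ≠ 0

lemma mem_nrset {n : ℕ} {q : Fin 4 → ℤ} :
    q ∈ nrset n ↔ (∀ i, q i ∈ freqs n) ∧ ∑ i, q i = 0 ∧ qphase q ≠ 0 := by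
  simp [nrset]

lemma sum_nrset_comp_perm {M : Type*} [AddCommMonoid M] (n : ℕ) (σ : Equiv.Perm (Fin 4))
    (F : (Fin 4 → ℤ) → M) : ∑ q ∈ nrset n, F (q ∘ σ) = ∑ q ∈ nrset n, F q := by
  refine Finset.sum_equiv (Equiv.arrowCongr σ.symm (Equiv.refl ℤ)) ?_ ?_
  · intro q
    have h1 : ∑ i, q (σ i) = ∑ i, q i := Equiv.sum_comp σ q
    have h2 : ∑ i, q (σ i) ^ 3 = ∑ i, q i ^ 3 := Equiv.sum_comp σ fun i => q i ^ 3
    have h3 : (∀ i, q (σ i) ∈ freqs n) ↔ ∀ i, q i ∈ freqs n :=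
      σ.forall_congr_left (p := fun i => q (σ i) ∈ freqs n) |>.trans (by simp)
    simp [mem_nrset, qphase, h1, h2, h3]
  · intro q _
    rfl

lemma Phi_eq_qphase {q : Fin 4 → ℤ} (h : ∑ i, q i = 0) : Phi (q 0) (q 1) (q 2) = qphase q := by
  rw [Fin.sum_univ_four] at h
  have : q 3 = -(q 0 + q 1 + q 2) := by linarith
  simp only [qphase, Phi, Fin.sum_univ_four, this]
  ring

/-- The phase is a product of pairwise sums. -/
lemma qphase_eq_mul {q : Fin 4 → ℤ} (h : ∑ i, q i = 0) :
    qphase q = 3 * ((q 0 + q 1) * (q 1 + q 2) * (q 2 + q 0)) := by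
  rw [← Phi_eq_qphase h, Phi]
  ring

lemma Nonres_eq_sum {n : ℕ} {u : ℤ → ℂ} (hu : ∀ k ∉ freqs n, u k = 0) (t : ℝ) (k : ℤ) :
    Nonres u t k = Complex.I / 3 * ∑ p ∈ freqs n ×ˢ freqs n, ntermF u t k p := by
  rw [Nonres, tsum_eq_sum]
  intro p hp
  rw [Finset.mem_product, not_and_or] at hp
  unfold ntermF
  rcases hp with h | h <;> simp [hu _ h]

lemma sum_conj_mul_ntermF {n : ℕ} {u : ℤ → ℂ} (hu : ∀ k ∉ freqs n, u k = 0)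
    (hr : ∀ k, u (-k) = starRingEnd ℂ (u k)) (t : ℝ) (W : ℤ → ℝ) :
    ∑ k ∈ freqs n, ∑ p ∈ freqs n ×ˢ freqs n,
        (W k : ℂ) * (starRingEnd ℂ (u k) * ntermF u t k p) =
      ∑ q ∈ nrset n, ((-(q 3) * W (-(q 3)) : ℝ) : ℂ) *
        (Complex.exp (Complex.I * t * (qphase q : ℤ)) * ∏ i, u (q i)) := by
  rw [← Finset.sum_product']
  rw [← Finset.sum_filter_of_ne (p := fun x : ℤ × ℤ × ℤ =>
    x.1 - x.2.1 - x.2.2 ∈ freqs n ∧ Phi x.2.1 x.2.2 (x.1 - x.2.1 - x.2.2) ≠ 0)]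
  · refine Finset.sum_nbij' (fun x => ![x.2.1, x.2.2, x.1 - x.2.1 - x.2.2, -x.1])
      (fun q => (-(q 3), q 0, q 1)) ?_ ?_ ?_ ?_ ?_
    · rintro ⟨k, a, b⟩ hx
      simp only [Finset.mem_filter, Finset.mem_product] at hx
      have hs : ∑ i, (![a, b, k - a - b, -k] : Fin 4 → ℤ) i = 0 := by
        simp [Fin.sum_univ_four]
      rw [mem_nrset]
      refine ⟨?_, hs, ?_⟩
      · rw [Fin.forall_fin_succ, Fin.forall_fin_succ, Fin.forall_fin_succ, Fin.forall_fin_one]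
        exact ⟨hx.1.2.1, hx.1.2.2, hx.2.1, neg_mem_freqs.2 hx.1.1⟩
      · rw [← Phi_eq_qphase hs]
        exact hx.2.2
    · intro q hq
      rw [mem_nrset] at hq
      have h2 : -(q 3) - q 0 - q 1 = q 2 := by
        have := hq.2.1
        rw [Fin.sum_univ_four] at this
        linarith
      simp only [Finset.mem_filter, Finset.mem_product, h2, Phi_eq_qphase hq.2.1]
      exact ⟨⟨neg_mem_freqs.2 (hq.1 3), hq.1 0, hq.1 1⟩, hq.1 2, hq.2.2⟩
    · rintro ⟨k, a, b⟩ _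
      simp
    · intro q hq
      rw [mem_nrset, Fin.sum_univ_four] at hq
      funext i
      fin_cases i
      · rfl
      · rfl
      · simp; linarith [hq.2.1]
      · simp
    · rintro ⟨k, a, b⟩ hx
      simp only [Finset.mem_filter, Finset.mem_product] at hx
      have hs : ∑ i, (![a, b, k - a - b, -k] : Fin 4 → ℤ) i = 0 := by
        simp [Fin.sum_univ_four]
      have hph := Phi_eq_qphase hs
      simp only [Matrix.cons_val] at hph
      rw [← hph, ntermF, if_pos hx.2.2, Fin.prod_univ_four, ← hr]
      simp only [Matrix.cons_val]
      push_cast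
      simp only [neg_neg]
      ring
  · rintro ⟨k, a, b⟩ _ hne
    by_contra h
    rw [not_and_or, not_not] at h
    apply hne
    rcases h with h | h
    · simp [ntermF, hu _ h]
    · simp [ntermF, h]

/-- Symmetrized formula for the time derivative of a weighted `ℓ²` norm. -/
lemma sum_weight_re_conj_mul {n : ℕ} {u : ℤ → ℂ} (hu : ∀ k ∉ freqs n, u k = 0)
    (hr : ∀ k, u (-k) = starRingEnd ℂ (u k)) (t : ℝ) {W : ℤ → ℝ} (hW : ∀ k, W (-k) = W k) :
    ∑ k ∈ freqs n, W k * (starRingEnd ℂ (u k) * (Nonres u t k + Res u k)).re =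
      -(1 / 12) * (Complex.I * ∑ q ∈ nrset n, ((∑ i, q i * W (q i) : ℝ) : ℂ) *
        (Complex.exp (Complex.I * t * (qphase q : ℤ)) * ∏ i, u (q i))).re := by
  set X : (Fin 4 → ℤ) → ℂ := fun q =>
    Complex.exp (Complex.I * t * (qphase q : ℤ)) * ∏ i, u (q i) with hX
  have hXσ : ∀ (σ : Equiv.Perm (Fin 4)) q, X (q ∘ σ) = X q := by
    intro σ q
    have h2 : ∑ i, q (σ i) ^ 3 = ∑ i, q i ^ 3 := Equiv.sum_comp σ fun i => q i ^ 3
    have h4 : ∏ i, u (q (σ i)) = ∏ i, u (q i) := Equiv.prod_comp σ fun i => u (q i)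
    simp only [hX, qphase, Function.comp_apply, h2, h4]
  have hres : ∀ k, (starRingEnd ℂ (u k) * Res u k).re = 0 := by
    intro k
    have : starRingEnd ℂ (u k) * Res u k = ((-(k * ‖u k‖ ^ 4) : ℝ) : ℂ) * Complex.I := by
      have h := Complex.conj_mul' (u k)
      simp only [Res]
      push_cast
      linear_combination (-Complex.I * k * (‖u k‖ : ℂ) ^ 2) * h
    rw [this, Complex.re_ofReal_mul, Complex.I_re, mul_zero]
  have h1 : ∑ k ∈ freqs n, W k * (starRingEnd ℂ (u k) * (Nonres u t k + Res u k)).re =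
      (∑ k ∈ freqs n, (W k : ℂ) * (starRingEnd ℂ (u k) * Nonres u t k)).re := by
    rw [Complex.re_sum]
    refine Finset.sum_congr rfl fun k _ => ?_
    rw [Complex.re_ofReal_mul, mul_add, Complex.add_re, hres, add_zero]
  have h2 : ∑ k ∈ freqs n, (W k : ℂ) * (starRingEnd ℂ (u k) * Nonres u t k) =
      Complex.I / 3 * ∑ q ∈ nrset n, ((-(q 3) * W (-(q 3)) : ℝ) : ℂ) * X q := by
    rw [← sum_conj_mul_ntermF hu hr, Finset.mul_sum]
    refine Finset.sum_congr rfl fun k _ => ?_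
    rw [Nonres_eq_sum hu, ← Finset.mul_sum, ← Finset.mul_sum]
    ring
  have h3 : ∀ i, ∑ q ∈ nrset n, ((q i * W (q i) : ℝ) : ℂ) * X q =
      ∑ q ∈ nrset n, ((q 3 * W (q 3) : ℝ) : ℂ) * X q := by
    intro i
    rw [← sum_nrset_comp_perm n (Equiv.swap i 3)]
    refine Finset.sum_congr rfl fun q _ => ?_
    rw [hXσ]
    simp
  have h4 : ∑ q ∈ nrset n, ((∑ i, q i * W (q i) : ℝ) : ℂ) * X q =
      4 * ∑ q ∈ nrset n, ((q 3 * W (q 3) : ℝ) : ℂ) * X q := by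
    have : ∀ q, ((∑ i, q i * W (q i) : ℝ) : ℂ) * X q =
        ∑ i, ((q i * W (q i) : ℝ) : ℂ) * X q := by
      intro q
      rw [Complex.ofReal_sum, Finset.sum_mul]
    simp_rw [this]
    rw [Finset.sum_comm]
    simp_rw [h3]
    simp
  have h5 : ∑ q ∈ nrset n, ((-(q 3) * W (-(q 3)) : ℝ) : ℂ) * X q =
      -∑ q ∈ nrset n, ((q 3 * W (q 3) : ℝ) : ℂ) * X q := by
    rw [← Finset.sum_neg_distrib]
    refine Finset.sum_congr rfl fun q _ => ?_
    rw [hW]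
    push_cast
    ring
  rw [h1, h2, h4, h5, ← Complex.re_ofReal_mul]
  congr 1
  push_cast
  ring

/-- A solution on `[0,T]` of the system truncated to frequencies of size at most `n`. -/
structure IsGalerkin (n : ℕ) (T : ℝ) (v : ℝ → ℤ → ℂ) : Prop where
  supp : ∀ t, ∀ k ∉ freqs n, v t k = 0
  real : ∀ t k, v t (-k) = starRingEnd ℂ (v t k)
  ode : ∀ t ∈ Set.Icc (0 : ℝ) T, ∀ k ∈ freqs n,
    HasDerivWithinAt (fun τ => v τ k) (Nonres (v t) t k + Res (v t) k) (Set.Icc (0 : ℝ) T) t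

lemma conj_Nonres_add_Res {u : ℤ → ℂ} (hr : ∀ k, u (-k) = starRingEnd ℂ (u k)) (t : ℝ) (k : ℤ) :
    starRingEnd ℂ (Nonres u t k + Res u k) = Nonres u t (-k) + Res u (-k) := by
  rw [map_add]
  congr 1
  · rw [Nonres, Nonres, map_mul, Complex.conj_tsum, ← (Equiv.neg (ℤ × ℤ)).tsum_eq (ntermF u t (-k))]
    have : ∀ p, ntermF u t (-k) (-p) = -starRingEnd ℂ (ntermF u t k p) := by
      rintro ⟨a, b⟩
      have hP : Phi (-a) (-b) (-k - -a - -b) = -Phi a b (k - a - b) := by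
        unfold Phi; ring
      have h3 : -k - -a - -b = -(k - a - b) := by ring
      simp only [ntermF, Prod.fst_neg, Prod.snd_neg, hP, neg_ne_zero]
      split_ifs
      · rw [h3, hr, hr, hr]
        simp only [map_mul, ← Complex.exp_conj, Complex.conj_I, Complex.conj_ofReal, map_intCast]
        push_cast
        ring_nf
      · simp
    simp only [Equiv.neg_apply, this, tsum_neg, map_div₀, Complex.conj_I]
    rw [show starRingEnd ℂ 3 = 3 from Complex.conj_ofReal 3]
    ring
  · simp only [Res, hr, map_mul, map_neg, Complex.conj_I, map_pow, Complex.conj_ofReal,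
      map_intCast, RCLike.norm_conj]
    push_cast
    ring

/-- Extension of a finite vector to a sequence with the symmetry of a real function. -/
noncomputable def symExt (n : ℕ) (x : freqs n → ℂ) (k : ℤ) : ℂ :=
  if h : k ∈ freqs n then (x ⟨k, h⟩ + starRingEnd ℂ (x ⟨-k, neg_mem_freqs.2 h⟩)) / 2 else 0

lemma symExt_of_notMem {n : ℕ} (x : freqs n → ℂ) {k : ℤ} (h : k ∉ freqs n) :
    symExt n x k = 0 := dif_neg h

lemma symExt_neg {n : ℕ} (x : freqs n → ℂ) (k : ℤ) :
    symExt n x (-k) = starRingEnd ℂ (symExt n x k) := by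
  by_cases h : k ∈ freqs n
  · rw [symExt, symExt, dif_pos h, dif_pos (neg_mem_freqs.2 h)]
    simp only [neg_neg, map_div₀, map_add, Complex.conj_conj]
    rw [show starRingEnd ℂ 2 = 2 from Complex.conj_ofReal 2, add_comm]
  · rw [symExt_of_notMem x h, symExt_of_notMem x (mt neg_mem_freqs.1 h), map_zero]

lemma contDiff_symExt (n : ℕ) (k : ℤ) : ContDiff ℝ 1 fun x => symExt n x k := by
  unfold symExt
  split_ifs with h
  · have h2 : ContDiff ℝ 1 fun x : freqs n → ℂ => starRingEnd ℂ (x ⟨-k, neg_mem_freqs.2 h⟩) :=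
      Complex.conjCLE.contDiff.comp (contDiff_apply ℝ ℂ _)
    exact ((contDiff_apply ℝ ℂ _).add h2).div_const 2
  · exact contDiff_const

/-- `1 + ∑ |x_k|²` for the symmetrized vector. -/
noncomputable def mass (n : ℕ) (x : freqs n → ℂ) : ℝ := 1 + ∑ k ∈ freqs n, ‖symExt n x k‖ ^ 2

lemma one_le_mass (n : ℕ) (x : freqs n → ℂ) : 1 ≤ mass n x :=
  le_add_of_nonneg_right (Finset.sum_nonneg fun _ _ => sq_nonneg _)

lemma norm_symExt_sq_le (n : ℕ) (x : freqs n → ℂ) (k : ℤ) : ‖symExt n x k‖ ^ 2 ≤ mass n x := by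
  by_cases h : k ∈ freqs n
  · have := Finset.single_le_sum (f := fun k => ‖symExt n x k‖ ^ 2) (fun _ _ => sq_nonneg _) h
    unfold mass
    linarith
  · rw [symExt_of_notMem x h]
    simpa using zero_le_one.trans (one_le_mass n x)

/-- The truncated vector field, rescaled so as to be bounded. -/
noncomputable def galerkinField (n : ℕ) (M t : ℝ) (x : freqs n → ℂ) : freqs n → ℂ := fun k =>
  (((M / mass n x) ^ 2 : ℝ) : ℂ) * (Nonres (symExt n x) t k + Res (symExt n x) k)

lemma contDiff_galerkinField (n : ℕ) (M : ℝ) :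
    ContDiff ℝ 1 fun z : ℝ × (freqs n → ℂ) => galerkinField n M z.1 z.2 := by
  rw [contDiff_pi]
  intro k
  have hs : ∀ k, ContDiff ℝ 1 fun z : ℝ × (freqs n → ℂ) => symExt n z.2 k := fun k =>
    (contDiff_symExt n k).comp contDiff_snd
  have hof : ContDiff ℝ 1 fun x : ℝ => (x : ℂ) := Complex.ofRealCLM.contDiff
  have hm : ContDiff ℝ 1 fun z : ℝ × (freqs n → ℂ) => mass n z.2 := by
    unfold mass
    exact contDiff_const.add (ContDiff.sum fun k _ => (hs k).norm_sq ℝ)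
  have hN : ContDiff ℝ 1 fun z : ℝ × (freqs n → ℂ) => Nonres (symExt n z.2) z.1 k := by
    simp_rw [fun z : ℝ × (freqs n → ℂ) =>
      Nonres_eq_sum (fun k hk => symExt_of_notMem z.2 hk) z.1 (k : ℤ)]
    refine contDiff_const.mul (ContDiff.sum fun p _ => ?_)
    unfold ntermF
    split_ifs with h
    · refine ContDiff.mul (ContDiff.mul (ContDiff.mul (contDiff_const.mul ?_) (hs _)) (hs _)) (hs _)
      refine ContDiff.cexp ?_
      exact (contDiff_const.mul (hof.comp contDiff_fst)).mul contDiff_const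
    · exact contDiff_const
  have hR : ContDiff ℝ 1 fun z : ℝ × (freqs n → ℂ) => Res (symExt n z.2) k := by
    unfold Res
    refine ContDiff.mul (contDiff_const.mul ?_) (hs _)
    simp_rw [← Complex.ofReal_pow]
    exact hof.comp ((hs k).norm_sq ℝ)
  unfold galerkinField
  refine ContDiff.mul (hof.comp ((contDiff_const.div hm fun z => ?_).pow 2)) (hN.add hR)
  exact (zero_lt_one.trans_le (one_le_mass n z.2)).ne'

lemma exists_norm_galerkinField_le (n : ℕ) (M : ℝ) :
    ∃ L : ℝ, 0 ≤ L ∧ ∀ t x, ‖galerkinField n M t x‖ ≤ L := by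
  refine ⟨M ^ 2 * (((freqs n ×ˢ freqs n).card + 1) * n), by positivity, fun t x => ?_⟩
  rw [pi_norm_le_iff_of_nonneg (by positivity)]
  intro k
  have hk : |((k : ℤ) : ℝ)| ≤ n := by
    have := mem_freqs.1 k.2
    exact_mod_cast this
  have hk' : ‖((k : ℤ) : ℂ)‖ ≤ n := by rwa [Complex.norm_intCast]
  have hD := one_le_mass n x
  set D := mass n x
  have h1 : ∀ j, ‖symExt n x j‖ ≤ D := by
    intro j
    have := norm_symExt_sq_le n x j
    nlinarith [norm_nonneg (symExt n x j), sq_nonneg (‖symExt n x j‖ - 1)]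
  have h3 : ∀ i j l, ‖symExt n x i‖ * ‖symExt n x j‖ * ‖symExt n x l‖ ≤ D ^ 2 := by
    intro i j l
    have hi := norm_symExt_sq_le n x i
    have hj := norm_symExt_sq_le n x j
    have : ‖symExt n x i‖ * ‖symExt n x j‖ ≤ D := by
      nlinarith [sq_nonneg (‖symExt n x i‖ - ‖symExt n x j‖)]
    calc _ ≤ D * D := mul_le_mul this (h1 l) (norm_nonneg _) (by linarith)
      _ = D ^ 2 := by ring
  have hterm : ∀ p, ‖ntermF (symExt n x) t k p‖ ≤ n * D ^ 2 := by
    intro p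
    unfold ntermF
    split_ifs
    · have he : ‖Complex.exp (Complex.I * (t : ℂ) *
          ((Phi p.1 p.2 (k - p.1 - p.2) : ℤ) : ℂ))‖ = 1 := by
        rw [Complex.norm_exp]
        simp
      rw [norm_mul, norm_mul, norm_mul, norm_mul, he, mul_one, mul_assoc, mul_assoc, ← mul_assoc ‖symExt n x p.1‖]
      gcongr
      exact h3 _ _ _
    · rw [norm_zero]; positivity
  have hN : ‖Nonres (symExt n x) t k‖ ≤ (freqs n ×ˢ freqs n).card * (n * D ^ 2) := by
    rw [Nonres_eq_sum (fun k hk => symExt_of_notMem x hk), norm_mul]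
    have : ‖Complex.I / 3‖ ≤ 1 := by simp; norm_num
    have h4 : ‖∑ p ∈ freqs n ×ˢ freqs n, ntermF (symExt n x) t k p‖ ≤
        (freqs n ×ˢ freqs n).card * (n * D ^ 2) := by
      refine (norm_sum_le _ _).trans ?_
      refine (Finset.sum_le_card_nsmul _ _ _ fun p _ => hterm p).trans ?_
      rw [nsmul_eq_mul]
    calc _ ≤ 1 * ((freqs n ×ˢ freqs n).card * (n * D ^ 2)) := by gcongr
      _ = _ := one_mul _
  have hR : ‖Res (symExt n x) k‖ ≤ n * D ^ 2 := by
    have := h3 k k k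
    unfold Res
    rw [norm_mul, norm_mul, norm_mul, norm_neg, Complex.norm_I, one_mul, norm_pow,
      Complex.norm_real, norm_norm, mul_assoc, sq]
    gcongr
  have hDpos : 0 < D := by linarith
  unfold galerkinField
  rw [norm_mul, Complex.norm_real, Real.norm_of_nonneg (sq_nonneg _)]
  calc (M / D) ^ 2 * ‖Nonres (symExt n x) t k + Res (symExt n x) k‖
      ≤ (M / D) ^ 2 * ((freqs n ×ˢ freqs n).card * (n * D ^ 2) + n * D ^ 2) := by
        gcongr
        exact (norm_add_le _ _).trans (add_le_add hN hR)
    _ = _ := by field_simp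

/-- The truncated system has solutions on every time interval. -/
lemma exists_isGalerkin (n : ℕ) {T : ℝ} (hT : 0 ≤ T) {u : ℤ → ℂ}
    (hr : ∀ k, u (-k) = starRingEnd ℂ (u k)) :
    ∃ v, IsGalerkin n T v ∧ ∀ k ∈ freqs n, v 0 k = u k := by
  set x₀ : freqs n → ℂ := fun k => u k with hx₀
  have hx₀u : ∀ k ∈ freqs n, symExt n x₀ k = u k := by
    intro k hk
    rw [symExt, dif_pos hk, hx₀]
    simp only [hr, Complex.conj_conj]
    ring
  set M := mass n x₀ with hM
  obtain ⟨L, hL, hbound⟩ := exists_norm_galerkinField_le n M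
  have hcd := contDiff_galerkinField n M
  have hcompact : IsCompact (Set.Icc (0 : ℝ) T ×ˢ Metric.closedBall x₀ (L * T)) :=
    isCompact_Icc.prod (isCompact_closedBall _ _)
  obtain ⟨K, hK⟩ := hcd.contDiffOn.exists_lipschitzOnWith (by norm_num)
    ((convex_Icc (0 : ℝ) T).prod (convex_closedBall x₀ (L * T))) hcompact
  have hPL : IsPicardLindelof (galerkinField n M) (tmin := 0) (tmax := T) ⟨0, le_rfl, hT⟩ x₀
      ⟨L * T, by positivity⟩ 0 ⟨L, hL⟩ K := by
    refine ⟨fun t ht => ?_, fun x _ => ?_, fun t _ x _ => hbound t x, ?_⟩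
    · intro x hx y hy
      have := hK (Set.mk_mem_prod ht hx) (Set.mk_mem_prod ht hy)
      simpa [Prod.edist_eq] using this
    · exact (hcd.continuous.comp (by fun_prop : Continuous fun t : ℝ => (t, x))).continuousOn
    · simp only [NNReal.coe_zero, sub_zero, max_eq_left hT]
      exact le_rfl
  obtain ⟨x, hx0, hx⟩ := hPL.exists_eq_forall_mem_Icc_hasDerivWithinAt₀
  have hsym : ∀ t ∈ Set.Icc (0 : ℝ) T, ∀ k ∈ freqs n,
      HasDerivWithinAt (fun τ => symExt n (x τ) k) ((((M / mass n (x t)) ^ 2 : ℝ) : ℂ) *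
        (Nonres (symExt n (x t)) t k + Res (symExt n (x t)) k)) (Set.Icc (0 : ℝ) T) t := by
    intro t ht k hk
    have hd := hasDerivWithinAt_pi.1 (hx t ht)
    have h1 := hd ⟨k, hk⟩
    have h2 := hd ⟨-k, neg_mem_freqs.2 hk⟩
    have h3 : HasDerivWithinAt (fun τ => starRingEnd ℂ (x τ ⟨-k, neg_mem_freqs.2 hk⟩)) _ _ t :=
      h2.star
    have h4 := (h1.add h3).div_const 2
    unfold symExt at h4 ⊢
    simp only [dif_pos hk]
    refine h4.congr_deriv ?_
    have hc := conj_Nonres_add_Res (symExt_neg (x t)) t k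
    change (galerkinField n M t (x t) ⟨k, hk⟩ +
      starRingEnd ℂ (galerkinField n M t (x t) ⟨-k, neg_mem_freqs.2 hk⟩)) / 2 = _
    simp only [galerkinField]
    rw [← hc, map_mul, Complex.conj_conj, Complex.conj_ofReal]
    change _ = _ * (Nonres (symExt n (x t)) t k + Res (symExt n (x t)) k)
    ring
  have hmass' : ∀ t ∈ Set.Icc (0 : ℝ) T,
      HasDerivWithinAt (fun τ => mass n (x τ)) 0 (Set.Icc (0 : ℝ) T) t := by
    intro t ht
    have h := (HasDerivWithinAt.fun_sum fun k hk => (hsym t ht k hk).norm_sq).const_add 1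
    refine h.congr_deriv ?_
    have hz := sum_weight_re_conj_mul (fun k hk => symExt_of_notMem (x t) hk)
      (symExt_neg (x t)) t (W := fun _ => 1) fun _ => rfl
    have hq : ∀ q ∈ nrset n, (∑ i, (q i : ℝ) * 1) = 0 := by
      intro q hq
      have := (mem_nrset.1 hq).2.1
      simp only [mul_one]
      exact_mod_cast this
    have hz0 : ∑ q ∈ nrset n, ((∑ i, (q i : ℝ) * 1 : ℝ) : ℂ) *
        (Complex.exp (Complex.I * t * (qphase q : ℤ)) * ∏ i, symExt n (x t) (q i)) = 0 :=
      Finset.sum_eq_zero fun q hqm => by rw [hq q hqm, Complex.ofReal_zero, zero_mul]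
    rw [hz0] at hz
    simp only [mul_zero, Complex.zero_re, one_mul] at hz
    refine Eq.trans ?_ (mul_zero (2 * (M / mass n (x t)) ^ 2))
    rw [← hz, Finset.mul_sum]
    refine Finset.sum_congr rfl fun k _ => ?_
    rw [Complex.inner, mul_assoc, Complex.re_ofReal_mul, mul_comm (starRingEnd ℂ _)]
    ring
  have hmass : ∀ t ∈ Set.Icc (0 : ℝ) T, mass n (x t) = M := by
    intro t ht
    have := (convex_Icc (0 : ℝ) T).norm_image_sub_le_of_norm_hasDerivWithin_le (C := 0)
      hmass' (fun _ _ => by simp) (Set.left_mem_Icc.2 hT) ht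
    rw [zero_mul, norm_le_zero_iff, sub_eq_zero, hx0] at this
    exact this
  refine ⟨fun t => symExt n (x t), ⟨fun t k hk => symExt_of_notMem _ hk,
    fun t k => symExt_neg _ k, fun t ht k hk => ?_⟩, fun k hk => ?_⟩
  · refine (hsym t ht k hk).congr_deriv ?_
    rw [hmass t ht, div_self (zero_lt_one.trans_le (one_le_mass n x₀)).ne']
    simp
  · simp only [hx0]
    exact hx₀u k hk

lemma enorm_le_envl {s : ℝ} (hs : 1 / 2 ≤ s) (u : ℤ → ℂ) (k : ℤ) : ‖u k‖ₑ ≤ envl s u k := by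
  rw [envl, ← ofReal_norm]
  refine ENNReal.ofReal_le_ofReal (le_mul_of_one_le_left (norm_nonneg _) ?_)
  exact Real.one_le_rpow (one_le_jb k) (by linarith)

lemma enorm_ntermF_le (u : ℤ → ℂ) (t : ℝ) (k : ℤ) (p : ℤ × ℤ) :
    ‖ntermF u t k p‖ₑ ≤
      ENNReal.ofReal |(k : ℝ)| * (‖u p.1‖ₑ * ‖u p.2‖ₑ * ‖u (k - p.1 - p.2)‖ₑ) := by
  unfold ntermF
  split_ifs
  · have he : ‖Complex.exp (Complex.I * (t : ℂ) *
        ((Phi p.1 p.2 (k - p.1 - p.2) : ℤ) : ℂ))‖ₑ = 1 := by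
      rw [← ofReal_norm, Complex.norm_exp]
      simp
    have hk : ‖(k : ℂ)‖ₑ = ENNReal.ofReal |(k : ℝ)| := by
      rw [← ofReal_norm, Complex.norm_intCast]
    rw [enorm_mul, enorm_mul, enorm_mul, enorm_mul, he, hk, mul_one]
    exact le_of_eq (by ring)
  · simp

lemma enorm_Nonres_add_Res_le {u : ℤ → ℂ} (hr : ∀ k, u (-k) = starRingEnd ℂ (u k)) (t : ℝ)
    (k : ℤ) :
    ‖Nonres u t k + Res u k‖ₑ ≤
      2 * ENNReal.ofReal |(k : ℝ)| * conv3 (fun j => ‖u j‖ₑ) k := by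
  have hk : ‖(k : ℂ)‖ₑ = ENNReal.ofReal |(k : ℝ)| := by
    rw [← ofReal_norm, Complex.norm_intCast]
  have h1 : ‖Nonres u t k‖ₑ ≤ ENNReal.ofReal |(k : ℝ)| * conv3 (fun j => ‖u j‖ₑ) k := by
    have h13 : ‖Complex.I / 3‖ₑ ≤ 1 := by
      rw [← ofReal_norm, ENNReal.ofReal_le_one]
      simp
      norm_num
    rw [Nonres, enorm_mul, conv3, ← ENNReal.tsum_mul_left]
    refine (mul_le_of_le_one_left zero_le h13).trans ?_
    exact (enorm_tsum_le_tsum_enorm).trans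
      (ENNReal.tsum_le_tsum fun p => enorm_ntermF_le u t k p)
  have h2 : ‖Res u k‖ₑ ≤ ENNReal.ofReal |(k : ℝ)| * conv3 (fun j => ‖u j‖ₑ) k := by
    have h3 : ‖u k‖ₑ * ‖u k‖ₑ * ‖u (k - k - k)‖ₑ ≤ conv3 (fun j => ‖u j‖ₑ) k :=
      ENNReal.le_tsum (f := fun p : ℤ × ℤ => ‖u p.1‖ₑ * ‖u p.2‖ₑ * ‖u (k - p.1 - p.2)‖ₑ) (k, k)
    have h4 : ‖u (k - k - k)‖ₑ = ‖u k‖ₑ := by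
      rw [sub_self, zero_sub, hr, ← ofReal_norm, RCLike.norm_conj, ofReal_norm]
    have h5 : ‖((‖u k‖ : ℝ) : ℂ)‖ₑ = ‖u k‖ₑ := by
      rw [← ofReal_norm, Complex.norm_real, norm_norm, ofReal_norm]
    have h6 : ‖-Complex.I‖ₑ = 1 := by
      rw [← ofReal_norm]
      simp
    rw [h4] at h3
    rw [Res, enorm_mul, enorm_mul, enorm_mul, enorm_pow, h5, hk, h6, one_mul, mul_assoc]
    gcongr
    rwa [sq]
  refine (enorm_add_le _ _).trans ((add_le_add h1 h2).trans (le_of_eq ?_))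
  ring

lemma weight_mul_conv3_le {s : ℝ} (hs : 5 / 12 ≤ s) (u : ℤ → ℂ) (k : ℤ) :
    ENNReal.ofReal (jb k ^ (s - 5 / 12)) * conv3 (fun j => ‖u j‖ₑ) k ≤ conv3 (envl s u) k := by
  have hα : 0 ≤ s - 5 / 12 := by linarith
  rw [conv3, conv3, ← ENNReal.tsum_mul_left]
  refine ENNReal.tsum_le_tsum fun p => ?_
  have hj := fun k => (jb_pos k).le
  have h : jb k ≤ jb p.1 * jb p.2 * jb (k - p.1 - p.2) := by
    have h1 := jb_add_le (p.1 + p.2) (k - p.1 - p.2)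
    rw [show p.1 + p.2 + (k - p.1 - p.2) = k by ring] at h1
    exact h1.trans (mul_le_mul_of_nonneg_right (jb_add_le _ _) (hj _))
  have h2 : jb k ^ (s - 5 / 12) ≤ jb p.1 ^ (s - 5 / 12) * jb p.2 ^ (s - 5 / 12) *
      jb (k - p.1 - p.2) ^ (s - 5 / 12) := by
    rw [← Real.mul_rpow (hj _) (hj _), ← Real.mul_rpow (mul_nonneg (hj _) (hj _)) (hj _)]
    exact Real.rpow_le_rpow (hj _) h hα
  simp only [envl, ← ofReal_norm]
  have hp := fun k => Real.rpow_nonneg (hj k) (s - 5 / 12)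
  have hp1 := hp p.1
  have hp2 := hp p.2
  have hp3 := hp (k - p.1 - p.2)
  have hpk := hp k
  rw [← ENNReal.ofReal_mul (by positivity), ← ENNReal.ofReal_mul (by positivity),
    ← ENNReal.ofReal_mul (by positivity), ← ENNReal.ofReal_mul (by positivity),
    ← ENNReal.ofReal_mul (by positivity)]
  refine ENNReal.ofReal_le_ofReal ?_
  calc _ ≤ (jb p.1 ^ (s - 5 / 12) * jb p.2 ^ (s - 5 / 12) *
      jb (k - p.1 - p.2) ^ (s - 5 / 12)) * (‖u p.1‖ * ‖u p.2‖ * ‖u (k - p.1 - p.2)‖) := by gcongr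
    _ = _ := by ring

lemma exists_conv3_envl_le : ∃ C : ℝ, 1 ≤ C ∧ ∀ (s : ℝ) (f : ℤ → ℂ) (R : ℝ), 0 ≤ R →
    sob s f ≤ ENNReal.ofReal (R ^ 2) →
      ∑' k, conv3 (envl s f) k ^ 2 ≤ ENNReal.ofReal ((C * R ^ 3) ^ 2) := by
  obtain ⟨C, hC, h⟩ := exists_conv3_envl_bound
  refine ⟨1 + C, by linarith, fun s f R hR hf => (h s f).trans ?_⟩
  calc _ ≤ ENNReal.ofReal C * ENNReal.ofReal (R ^ 2) ^ 3 := by gcongr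
    _ = ENNReal.ofReal (C * (R ^ 2) ^ 3) := by
      rw [ENNReal.ofReal_mul hC, ENNReal.ofReal_pow (sq_nonneg R)]
    _ ≤ _ := by
      refine ENNReal.ofReal_le_ofReal ?_
      have : (C * (R ^ 2) ^ 3) = C * R ^ 6 := by ring
      rw [this, mul_pow, ← pow_mul]
      refine mul_le_mul_of_nonneg_right ?_ (by positivity)
      nlinarith

lemma le_ofReal_of_tsum_sq_le {ι : Type*} {f : ι → ℝ≥0∞} {a : ℝ} (ha : 0 ≤ a)
    (h : ∑' i, f i ^ 2 ≤ ENNReal.ofReal (a ^ 2)) (i : ι) : f i ≤ ENNReal.ofReal a := by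
  rw [ENNReal.ofReal_pow ha] at h
  exact (ENNReal.pow_le_pow_left_iff two_ne_zero).1 ((ENNReal.le_tsum i).trans h)

lemma jb_sq_le_prod {q : Fin 4 → ℤ} (h : ∑ i, q i = 0) (i : Fin 4) :
    jb (q i) ^ 2 ≤ ∏ j, jb (q j) := by
  have hj := fun k => (jb_pos k).le
  have key : ∀ a b c d : ℤ, a + b + c + d = 0 → jb a ≤ jb b * jb c * jb d := by
    intro a b c d h
    rw [show a = -((b + c) + d) by linarith, jb_neg]
    exact (jb_add_le _ _).trans (mul_le_mul_of_nonneg_right (jb_add_le _ _) (hj _))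
  rw [Fin.sum_univ_four] at h
  rw [Fin.prod_univ_four, sq]
  have h0 := mul_le_mul_of_nonneg_left (key (q 0) (q 1) (q 2) (q 3) h) (hj (q 0))
  have h1 := mul_le_mul_of_nonneg_left
    (key (q 1) (q 0) (q 2) (q 3) (by linarith)) (hj (q 1))
  have h2 := mul_le_mul_of_nonneg_left
    (key (q 2) (q 0) (q 1) (q 3) (by linarith)) (hj (q 2))
  have h3 := mul_le_mul_of_nonneg_left
    (key (q 3) (q 0) (q 1) (q 2) (by linarith)) (hj (q 3))
  fin_cases i <;> simp only [Fin.zero_eta, Fin.mk_one, Fin.reduceFinMk] <;> linarith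

/-- The multiplier of the symmetric modified energy. -/
noncomputable def mult (s K : ℝ) (q : Fin 4 → ℤ) : ℝ := ∑ i, oddCut (2 * s + 1) K (q i)

lemma abs_mult_mul_jb_le {s K : ℝ} (hs : 1 / 2 ≤ s) (hK : 1 ≤ K) {q : Fin 4 → ℤ}
    (h : ∑ i, q i = 0) (i : Fin 4) :
    |mult s K q| * jb (q i) ≤ 2 * ((2 * s + 1) * (2 * s)) * K ^ (-(1 / 6 : ℝ)) *
      |(qphase q : ℝ)| * ∏ j, jb (q j) ^ (s - 5 / 12) := by
  obtain ⟨m, hm⟩ := Finite.exists_max fun j => |(q j : ℝ)|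
  set N := |(q m : ℝ)| with hN
  have hprod : 0 ≤ ∏ j, jb (q j) ^ (s - 5 / 12) :=
    Finset.prod_nonneg fun j _ => Real.rpow_nonneg (jb_pos _).le _
  rcases le_or_gt N K with hNK | hNK
  · have : mult s K q = 0 := Finset.sum_eq_zero fun j _ => oddCut_of_abs_le ((hm j).trans hNK)
    rw [this]
    simp only [abs_zero, zero_mul]
    have : 0 ≤ K ^ (-(1 / 6 : ℝ)) := Real.rpow_nonneg (by linarith) _
    have : 0 ≤ 2 * ((2 * s + 1) * (2 * s)) := by nlinarith
    positivity
  · have hN0 : 0 < N := by linarith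
    have hsum : (q 0 : ℝ) + q 1 + q 2 + q 3 = 0 := by
      rw [Fin.sum_univ_four] at h
      exact_mod_cast h
    have hmax : N = |(q 0 : ℝ)| ∨ N = |(q 1 : ℝ)| ∨ N = |(q 2 : ℝ)| ∨ N = |(q 3 : ℝ)| := by
      rw [hN]
      fin_cases m <;> simp
    have h1 := abs_oddCut_sum_le (p := 2 * s + 1) (by linarith) (by linarith : 0 ≤ K) hN0 hsum
      (hm 0) (hm 1) (hm 2) (hm 3) hmax
    have h2 : |mult s K q| ≤ (2 * s + 1) * (2 * s) * N ^ (2 * s - 2) * |(qphase q : ℝ)| := by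
      rw [mult, Fin.sum_univ_four]
      refine h1.trans (le_of_eq ?_)
      rw [qphase_eq_mul h]
      push_cast
      ring_nf
    have h3 : jb (q i) ≤ 2 * N := by
      have := hm i
      unfold jb
      linarith
    have h4 : N ^ (2 * s - 1) ≤ K ^ (-(1 / 6 : ℝ)) * ∏ j, jb (q j) ^ (s - 5 / 12) := by
      have e1 : N ^ (2 * s - 1) = N ^ (-(1 / 6 : ℝ)) * (N ^ 2) ^ (s - 5 / 12) := by
        rw [← Real.rpow_natCast N 2, ← Real.rpow_mul hN0.le, ← Real.rpow_add hN0]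
        congr 1
        push_cast
        ring
      rw [e1, Real.finsetProd_rpow _ _ fun j _ => (jb_pos (q j)).le]
      have e2 : N ^ (-(1 / 6 : ℝ)) ≤ K ^ (-(1 / 6 : ℝ)) :=
        Real.rpow_le_rpow_of_nonpos (by linarith) hNK.le (by norm_num)
      have e3 : N ^ 2 ≤ ∏ j, jb (q j) :=
        (pow_le_pow_left₀ hN0.le (abs_le_jb _) 2).trans (jb_sq_le_prod h m)
      exact mul_le_mul e2 (Real.rpow_le_rpow (sq_nonneg N) e3 (by linarith))
        (Real.rpow_nonneg (sq_nonneg N) _) (Real.rpow_nonneg (by linarith) _)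
    have h5 : N ^ (2 * s - 2) * N = N ^ (2 * s - 1) := by
      nth_rewrite 2 [← Real.rpow_one N]
      rw [← Real.rpow_add hN0]
      congr 1
      ring
    have hs0 : 0 ≤ (2 * s + 1) * (2 * s) := by nlinarith
    have hNs : 0 ≤ N ^ (2 * s - 2) := Real.rpow_nonneg hN0.le _
    calc |mult s K q| * jb (q i)
        ≤ ((2 * s + 1) * (2 * s) * N ^ (2 * s - 2) * |(qphase q : ℝ)|) * (2 * N) :=
          mul_le_mul h2 h3 (jb_pos _).le (by positivity)
      _ = 2 * ((2 * s + 1) * (2 * s)) * |(qphase q : ℝ)| * (N ^ (2 * s - 2) * N) := by ring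
      _ ≤ 2 * ((2 * s + 1) * (2 * s)) * |(qphase q : ℝ)| *
          (K ^ (-(1 / 6 : ℝ)) * ∏ j, jb (q j) ^ (s - 5 / 12)) := by
        rw [h5]
        gcongr
      _ = _ := by ring

lemma sum_nrset_le (n : ℕ) (e G : ℤ → ℝ≥0∞) (i : Fin 4) :
    ∑ q ∈ nrset n, (∏ j ∈ Finset.univ.erase i, e (q j)) * G (q i) ≤
      ∑' k, conv3 e k * G (-k) := by
  have h1 : ∑ q ∈ nrset n, (∏ j ∈ Finset.univ.erase i, e (q j)) * G (q i) =
      ∑ q ∈ nrset n, (∏ j ∈ Finset.univ.erase 3, e (q j)) * G (q 3) := by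
    rw [← sum_nrset_comp_perm n (Equiv.swap i 3)]
    refine Finset.sum_congr rfl fun q _ => ?_
    simp only [Function.comp_apply, Equiv.swap_apply_left]
    congr 1
    refine Finset.prod_equiv (Equiv.swap i 3) ?_ fun _ _ => rfl
    intro j
    simp only [Finset.mem_erase, Finset.mem_univ, and_true]
    rw [not_iff_not, Equiv.swap_apply_eq_iff, Equiv.swap_apply_right]
  have h2 : ∀ q : Fin 4 → ℤ, ∏ j ∈ Finset.univ.erase (3 : Fin 4), e (q j) =
      e (q 0) * e (q 1) * e (q 2) := by
    intro q
    rw [show Finset.univ.erase (3 : Fin 4) = {0, 1, 2} by decide]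
    rw [Finset.prod_insert (by decide), Finset.prod_insert (by decide), Finset.prod_singleton,
      mul_assoc]
  rw [h1]
  have h3 : ∑' k, conv3 e k * G (-k) =
      ∑' z : ℤ × ℤ × ℤ, e z.2.1 * e z.2.2 * e (z.1 - z.2.1 - z.2.2) * G (-z.1) := by
    rw [ENNReal.tsum_prod']
    refine tsum_congr fun k => ?_
    exact ENNReal.tsum_mul_right.symm
  rw [h3]
  set f : (Fin 4 → ℤ) → ℤ × ℤ × ℤ := fun q => (-q 3, q 0, q 1) with hf
  have hq2 : ∀ q ∈ nrset n, q 2 = -q 3 - q 0 - q 1 := by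
    intro q hq
    have := (mem_nrset.1 hq).2.1
    rw [Fin.sum_univ_four] at this
    linarith
  have hinj : Set.InjOn f (nrset n) := by
    intro q hq q' hq' h
    simp only [hf, Prod.mk.injEq, neg_inj] at h
    have e2 : q 2 = q' 2 := by rw [hq2 q hq, hq2 q' hq', h.1, h.2.1, h.2.2]
    funext j
    fin_cases j
    exacts [h.2.1, h.2.2, e2, h.1]
  calc _ = ∑ z ∈ (nrset n).image f,
      e z.2.1 * e z.2.2 * e (z.1 - z.2.1 - z.2.2) * G (-z.1) := by
        rw [Finset.sum_image hinj]
        refine Finset.sum_congr rfl fun q hq => ?_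
        rw [h2, hq2 q hq]
        simp only [hf, neg_neg]
    _ ≤ _ := ENNReal.sum_le_tsum _

lemma sum_nrset_le_ofReal (n : ℕ) {e G : ℤ → ℝ≥0∞} {a b : ℝ} (ha : 0 ≤ a) (hb : 0 ≤ b)
    (he : ∑' k, conv3 e k ^ 2 ≤ ENNReal.ofReal (a ^ 2))
    (hG : ∑' k, G k ^ 2 ≤ ENNReal.ofReal (b ^ 2)) (i : Fin 4) :
    ∑ q ∈ nrset n, (∏ j ∈ Finset.univ.erase i, e (q j)) * G (q i) ≤ ENNReal.ofReal (a * b) := by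
  refine (sum_nrset_le n e G i).trans ((ENNReal.pow_le_pow_left_iff two_ne_zero).1 ?_)
  refine (ENNReal.tsum_mul_sq_le _ _).trans ?_
  have hn : ∑' k, G (-k) ^ 2 = ∑' k, G k ^ 2 := (Equiv.neg ℤ).tsum_eq fun k => G k ^ 2
  rw [hn, ← ENNReal.ofReal_pow (by positivity), mul_pow,
    ENNReal.ofReal_mul (by positivity)]
  gcongr

lemma envl_eq_mul (s : ℝ) (u : ℤ → ℂ) (k : ℤ) :
    envl s u k = ENNReal.ofReal (jb k ^ (s - 5 / 12)) * ‖u k‖ₑ := by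
  rw [envl, ENNReal.ofReal_mul (Real.rpow_nonneg (jb_pos k).le _), ofReal_norm]

lemma enorm_finsetProd {ι : Type*} (S : Finset ι) (f : ι → ℂ) :
    ‖∏ i ∈ S, f i‖ₑ = ∏ i ∈ S, ‖f i‖ₑ := by
  simp only [enorm_eq_nnnorm, nnnorm_prod, ENNReal.ofNNReal_finsetProd]

/-- The coefficient of the quartic correction to the energy. -/
noncomputable def corr (s K : ℝ) (q : Fin 4 → ℤ) : ℝ := mult s K q / qphase q

/-- The weight `k ↦ oddCut k / k`, comparable to `⟨k⟩^{2s}` for `|k| ≥ 2K`. -/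
noncomputable def cutWeight (s K : ℝ) (k : ℤ) : ℝ := oddCut (2 * s + 1) K k / k

lemma cutWeight_neg (s K : ℝ) (k : ℤ) : cutWeight s K (-k) = cutWeight s K k := by
  rw [cutWeight, cutWeight, Int.cast_neg, oddCut_neg, neg_div_neg_eq]

lemma mul_cutWeight (s : ℝ) {K : ℝ} (hK : 0 ≤ K) (k : ℤ) :
    k * cutWeight s K k = oddCut (2 * s + 1) K k := by
  rcases eq_or_ne k 0 with rfl | hk
  · rw [oddCut_of_abs_le (by simpa using hK)]
    simp
  · rw [cutWeight, mul_div_cancel₀]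
    exact_mod_cast hk

lemma enorm_corr_mul_le {s K : ℝ} (hs : 1 / 2 ≤ s) (hK : 1 ≤ K) {q : Fin 4 → ℤ}
    (h : ∑ i, q i = 0) (hq : qphase q ≠ 0) (i : Fin 4) :
    ‖(corr s K q : ℂ)‖ₑ * ENNReal.ofReal (jb (q i)) ≤
      ENNReal.ofReal (2 * ((2 * s + 1) * (2 * s)) * K ^ (-(1 / 6 : ℝ))) *
        ((∏ j ∈ Finset.univ.erase i, ENNReal.ofReal (jb (q j) ^ (s - 5 / 12))) *
          ENNReal.ofReal (jb (q i) ^ (s - 5 / 12))) := by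
  have hp : ∀ j, 0 ≤ jb (q j) ^ (s - 5 / 12) := fun j => Real.rpow_nonneg (jb_pos _).le _
  have hM : 0 ≤ 2 * ((2 * s + 1) * (2 * s)) * K ^ (-(1 / 6 : ℝ)) :=
    mul_nonneg (by nlinarith) (Real.rpow_nonneg (by linarith) _)
  rw [Finset.prod_erase_mul _ _ (Finset.mem_univ i),
    ← ENNReal.ofReal_prod_of_nonneg fun j _ => hp j,
    ← ENNReal.ofReal_mul hM, ← ofReal_norm, ← ENNReal.ofReal_mul (norm_nonneg _)]
  refine ENNReal.ofReal_le_ofReal ?_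
  have hq' : 0 < |(qphase q : ℝ)| := abs_pos.2 (by exact_mod_cast hq)
  rw [Complex.norm_real, corr, norm_div, Real.norm_eq_abs, Real.norm_eq_abs, div_mul_eq_mul_div,
    div_le_iff₀ hq']
  refine (abs_mult_mul_jb_le hs hK h i).trans (le_of_eq (by ring))

lemma enorm_exp_I_mul (t : ℝ) (m : ℤ) : ‖Complex.exp (Complex.I * t * (m : ℤ))‖ₑ = 1 := by
  rw [← ofReal_norm, Complex.norm_exp]
  simp

/-- The quartic correction to the energy. -/
noncomputable def quartic (s K : ℝ) (n : ℕ) (u : ℤ → ℂ) (t : ℝ) : ℂ :=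
  ∑ q ∈ nrset n, (corr s K q : ℂ) * (Complex.exp (Complex.I * t * (qphase q : ℤ)) * ∏ i, u (q i))

lemma exists_norm_quartic_le {s : ℝ} (hs : 1 / 2 ≤ s) : ∃ C : ℝ, 0 ≤ C ∧
    ∀ (n : ℕ) (K R t : ℝ) (u : ℤ → ℂ), 1 ≤ K → 0 ≤ R → sob s u ≤ ENNReal.ofReal (R ^ 2) →
      ‖quartic s K n u t‖ ≤ C * K ^ (-(1 / 6 : ℝ)) * R ^ 4 := by
  obtain ⟨C, hC, hb⟩ := exists_conv3_envl_le
  refine ⟨2 * ((2 * s + 1) * (2 * s)) * C, mul_nonneg (by nlinarith) (by linarith),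
    fun n K R t u hK hR hu => ?_⟩
  have hM : 0 ≤ 2 * ((2 * s + 1) * (2 * s)) * K ^ (-(1 / 6 : ℝ)) :=
    mul_nonneg (by nlinarith) (Real.rpow_nonneg (by linarith) _)
  have hfin : 0 ≤ 2 * ((2 * s + 1) * (2 * s)) * C * K ^ (-(1 / 6 : ℝ)) * R ^ 4 := by
    have : 0 ≤ 2 * ((2 * s + 1) * (2 * s)) * K ^ (-(1 / 6 : ℝ)) * (C * R ^ 4) := by positivity
    linarith
  rw [← ENNReal.ofReal_le_ofReal_iff hfin, ofReal_norm]
  calc ‖quartic s K n u t‖ₑ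
      ≤ ∑ q ∈ nrset n, ENNReal.ofReal (2 * ((2 * s + 1) * (2 * s)) * K ^ (-(1 / 6 : ℝ))) *
          ((∏ j ∈ Finset.univ.erase 0, envl s u (q j)) * envl s u (q 0)) := by
        refine (enorm_sum_le _ _).trans (Finset.sum_le_sum fun q hq => ?_)
        obtain ⟨-, h0, hph⟩ := mem_nrset.1 hq
        rw [enorm_mul, enorm_mul, enorm_exp_I_mul, one_mul, enorm_finsetProd]
        have h1 : ‖(corr s K q : ℂ)‖ₑ ≤ ‖(corr s K q : ℂ)‖ₑ * ENNReal.ofReal (jb (q 0)) := by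
          refine le_mul_of_one_le_right zero_le ?_
          rw [← ENNReal.ofReal_one]
          exact ENNReal.ofReal_le_ofReal (one_le_jb _)
        refine (mul_le_mul_left (h1.trans (enorm_corr_mul_le hs hK h0 hph 0)) _).trans ?_
        rw [Finset.prod_erase_mul _ _ (Finset.mem_univ 0),
          Finset.prod_erase_mul _ _ (Finset.mem_univ 0), mul_assoc, ← Finset.prod_mul_distrib]
        simp only [envl_eq_mul, le_refl]
    _ ≤ ENNReal.ofReal (2 * ((2 * s + 1) * (2 * s)) * K ^ (-(1 / 6 : ℝ))) *
          ENNReal.ofReal (C * R ^ 3 * R) := by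
        rw [← Finset.mul_sum]
        gcongr
        exact sum_nrset_le_ofReal n (by positivity) hR (hb s u R hR hu)
          ((tsum_envl_sq_le s u).trans hu) 0
    _ = _ := by
        rw [← ENNReal.ofReal_mul hM]
        congr 1
        ring

/-- The part of the time derivative of the quartic correction coming from the equation. -/
noncomputable def quarticRem (s K : ℝ) (n : ℕ) (u : ℤ → ℂ) (t : ℝ) : ℂ :=
  ∑ q ∈ nrset n, (corr s K q : ℂ) * (Complex.exp (Complex.I * t * (qphase q : ℤ)) *
    ∑ i, (∏ j ∈ Finset.univ.erase i, u (q j)) * (Nonres u t (q i) + Res u (q i)))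

lemma exists_norm_quarticRem_le {s : ℝ} (hs : 1 / 2 ≤ s) : ∃ C : ℝ, 0 ≤ C ∧
    ∀ (n : ℕ) (K R t : ℝ) (u : ℤ → ℂ), (∀ k, u (-k) = starRingEnd ℂ (u k)) →
      1 ≤ K → 0 ≤ R → sob s u ≤ ENNReal.ofReal (R ^ 2) →
      ‖quarticRem s K n u t‖ ≤ C * K ^ (-(1 / 6 : ℝ)) * R ^ 6 := by
  obtain ⟨C, hC, hb⟩ := exists_conv3_envl_le
  refine ⟨8 * (2 * ((2 * s + 1) * (2 * s))) * C ^ 2, mul_nonneg (by nlinarith) (by positivity),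
    fun n K R t u hr hK hR hu => ?_⟩
  have hM : 0 ≤ 2 * ((2 * s + 1) * (2 * s)) * K ^ (-(1 / 6 : ℝ)) :=
    mul_nonneg (by nlinarith) (Real.rpow_nonneg (by linarith) _)
  have hfin : 0 ≤ 8 * (2 * ((2 * s + 1) * (2 * s))) * C ^ 2 * K ^ (-(1 / 6 : ℝ)) * R ^ 6 := by
    have : 0 ≤ 2 * ((2 * s + 1) * (2 * s)) * K ^ (-(1 / 6 : ℝ)) * (8 * (C ^ 2 * R ^ 6)) := by
      positivity
    linarith
  set M := 2 * ((2 * s + 1) * (2 * s)) * K ^ (-(1 / 6 : ℝ)) with hMdef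
  rw [← ENNReal.ofReal_le_ofReal_iff hfin, ofReal_norm]
  have hterm : ∀ q ∈ nrset n, ∀ i, ‖(corr s K q : ℂ)‖ₑ *
      ‖(∏ j ∈ Finset.univ.erase i, u (q j)) * (Nonres u t (q i) + Res u (q i))‖ₑ ≤
      2 * ENNReal.ofReal M *
        ((∏ j ∈ Finset.univ.erase i, envl s u (q j)) * conv3 (envl s u) (q i)) := by
    intro q hq i
    obtain ⟨-, h0, hph⟩ := mem_nrset.1 hq
    have h1 := enorm_corr_mul_le hs hK h0 hph i
    rw [← hMdef] at h1
    have h2 := enorm_Nonres_add_Res_le hr t (q i)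
    have h3 := weight_mul_conv3_le (by linarith : 5 / 12 ≤ s) u (q i)
    set c := ‖(corr s K q : ℂ)‖ₑ
    set P := ∏ j ∈ Finset.univ.erase i, ‖u (q j)‖ₑ with hP
    set J := ∏ j ∈ Finset.univ.erase i, ENNReal.ofReal (jb (q j) ^ (s - 5 / 12)) with hJ
    set V := conv3 (fun j => ‖u j‖ₑ) (q i)
    set w := ENNReal.ofReal (jb (q i) ^ (s - 5 / 12))
    have hJP : ∏ j ∈ Finset.univ.erase i, envl s u (q j) = J * P := by
      rw [hJ, hP, ← Finset.prod_mul_distrib]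
      simp only [envl_eq_mul]
    rw [enorm_mul, enorm_finsetProd, hJP, ← hP]
    calc c * (P * ‖Nonres u t (q i) + Res u (q i)‖ₑ)
        ≤ c * (P * (2 * ENNReal.ofReal (jb (q i)) * V)) := by
          gcongr
          refine h2.trans ?_
          gcongr
          exact abs_le_jb _
      _ = 2 * (c * ENNReal.ofReal (jb (q i))) * (P * V) := by ring
      _ ≤ 2 * (ENNReal.ofReal M * (J * w)) * (P * V) := by gcongr
      _ = 2 * ENNReal.ofReal M * (J * P * (w * V)) := by ring
      _ ≤ _ := by gcongr
  calc ‖quarticRem s K n u t‖ₑ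
      ≤ ∑ q ∈ nrset n, ∑ i, 2 * ENNReal.ofReal M *
        ((∏ j ∈ Finset.univ.erase i, envl s u (q j)) * conv3 (envl s u) (q i)) := by
        refine (enorm_sum_le _ _).trans (Finset.sum_le_sum fun q hq => ?_)
        rw [enorm_mul, enorm_mul, enorm_exp_I_mul, one_mul]
        refine (mul_le_mul_right (enorm_sum_le _ _) _).trans ?_
        rw [Finset.mul_sum]
        exact Finset.sum_le_sum fun i _ => hterm q hq i
    _ ≤ ∑ _i : Fin 4, 2 * ENNReal.ofReal M * ENNReal.ofReal (C * R ^ 3 * (C * R ^ 3)) := by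
        rw [Finset.sum_comm]
        refine Finset.sum_le_sum fun i _ => ?_
        rw [← Finset.mul_sum]
        gcongr
        exact sum_nrset_le_ofReal n (by positivity) (by positivity) (hb s u R hR hu)
          (hb s u R hR hu) i
    _ = _ := by
        rw [Finset.sum_const, Finset.card_univ, Fintype.card_fin, nsmul_eq_mul, mul_assoc,
          ← ENNReal.ofReal_mul hM, ← mul_assoc,
          show ((4 : ℕ) : ℝ≥0∞) * 2 = ENNReal.ofReal 8 by norm_num,
          ← ENNReal.ofReal_mul (by norm_num), hMdef]
        congr 1
        ring

lemma IsGalerkin.hasDerivWithinAt_energy {n : ℕ} {T : ℝ} {v : ℝ → ℤ → ℂ} (h : IsGalerkin n T v)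
    {W : ℤ → ℝ} (hW : ∀ k, W (-k) = W k) {t : ℝ} (ht : t ∈ Set.Icc (0 : ℝ) T) :
    HasDerivWithinAt (fun τ => ∑ k ∈ freqs n, W k * ‖v τ k‖ ^ 2)
      (-(1 / 6) * (Complex.I * ∑ q ∈ nrset n, ((∑ i, q i * W (q i) : ℝ) : ℂ) *
        (Complex.exp (Complex.I * t * (qphase q : ℤ)) * ∏ i, v t (q i))).re)
      (Set.Icc (0 : ℝ) T) t := by
  have hd := HasDerivWithinAt.fun_sum fun k hk => ((h.ode t ht k hk).norm_sq).const_mul (W k)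
  refine hd.congr_deriv ?_
  have hz := sum_weight_re_conj_mul (h.supp t) (h.real t) t hW
  have : -(1 / 6) * (Complex.I * ∑ q ∈ nrset n, ((∑ i, q i * W (q i) : ℝ) : ℂ) *
        (Complex.exp (Complex.I * t * (qphase q : ℤ)) * ∏ i, v t (q i))).re =
      2 * ∑ k ∈ freqs n, W k * (starRingEnd ℂ (v t k) * (Nonres (v t) t k + Res (v t) k)).re := by
    rw [hz]
    ring
  rw [this, Finset.mul_sum]
  refine Finset.sum_congr rfl fun k _ => ?_
  rw [Complex.inner, mul_comm (starRingEnd ℂ _)]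
  ring

lemma IsGalerkin.hasDerivWithinAt_quartic {n : ℕ} {T : ℝ} {v : ℝ → ℤ → ℂ} (h : IsGalerkin n T v)
    (s K : ℝ) {t : ℝ} (ht : t ∈ Set.Icc (0 : ℝ) T) :
    HasDerivWithinAt (fun τ => quartic s K n (v τ) τ)
      (Complex.I * ∑ q ∈ nrset n, (mult s K q : ℂ) *
        (Complex.exp (Complex.I * t * (qphase q : ℤ)) * ∏ i, v t (q i)) +
        quarticRem s K n (v t) t) (Set.Icc (0 : ℝ) T) t := by
  have hexp : ∀ m : ℤ, HasDerivWithinAt (fun τ : ℝ => Complex.exp (Complex.I * τ * (m : ℤ)))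
      (Complex.exp (Complex.I * t * (m : ℤ)) * (Complex.I * m)) (Set.Icc (0 : ℝ) T) t := by
    intro m
    have h1 : HasDerivAt (fun τ : ℝ => Complex.I * (τ : ℂ) * (m : ℂ)) (Complex.I * m) t := by
      have := ((Complex.ofRealCLM.hasDerivAt (x := t)).const_mul Complex.I).mul_const (m : ℂ)
      simpa using! this
    exact h1.cexp.hasDerivWithinAt
  have hd := HasDerivWithinAt.fun_sum fun q (hq : q ∈ nrset n) =>
    ((hexp (qphase q)).mul (HasDerivWithinAt.fun_finsetProd (u := Finset.univ)
      fun i _ => h.ode t ht (q i) ((mem_nrset.1 hq).1 i))).const_mul (corr s K q : ℂ)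
  refine hd.congr_deriv ?_
  rw [quarticRem, Finset.mul_sum, ← Finset.sum_add_distrib]
  refine Finset.sum_congr rfl fun q hq => ?_
  have hm : (mult s K q : ℂ) = corr s K q * (qphase q : ℤ) := by
    have : ((qphase q : ℤ) : ℝ) ≠ 0 := by exact_mod_cast (mem_nrset.1 hq).2.2
    have h2 : mult s K q = corr s K q * (qphase q : ℤ) := by
      rw [corr, div_mul_cancel₀ _ this]
    rw [h2]
    push_cast
    rfl
  rw [hm]
  simp only [smul_eq_mul]
  ring

lemma exists_energy_bound {s : ℝ} (hs : 1 / 2 ≤ s) : ∃ C : ℝ, 1 ≤ C ∧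
    ∀ (n : ℕ) (T : ℝ) (v : ℝ → ℤ → ℂ), IsGalerkin n T v → ∀ K R t : ℝ, 1 ≤ K → 1 ≤ R →
      t ∈ Set.Icc (0 : ℝ) T → (∀ τ ∈ Set.Icc (0 : ℝ) t, sob s (v τ) ≤ ENNReal.ofReal (R ^ 2)) →
      ∑ k ∈ freqs n, cutWeight s K k * ‖v t k‖ ^ 2 ≤
        ∑ k ∈ freqs n, cutWeight s K k * ‖v 0 k‖ ^ 2 + C * K ^ (-(1 / 6 : ℝ)) * R ^ 6 * (1 + t) := by
  obtain ⟨C₁, hC₁, hb₁⟩ := exists_norm_quartic_le hs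
  obtain ⟨C₂, hC₂, hb₂⟩ := exists_norm_quarticRem_le hs
  refine ⟨1 + C₁ + C₂, by linarith, fun n T v h K R t hK hR ht hsob => ?_⟩
  set E : ℝ → ℝ := fun τ => ∑ k ∈ freqs n, cutWeight s K k * ‖v τ k‖ ^ 2 with hE
  have hd : ∀ τ ∈ Set.Icc (0 : ℝ) t, HasDerivWithinAt
      (fun τ => E τ + (1 / 6) * (quartic s K n (v τ) τ).re)
      ((1 / 6) * (quarticRem s K n (v τ) τ).re) (Set.Icc (0 : ℝ) t) τ := by
    intro τ hτ
    have hτT : τ ∈ Set.Icc (0 : ℝ) T := ⟨hτ.1, hτ.2.trans ht.2⟩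
    have h1 := h.hasDerivWithinAt_energy (cutWeight_neg s K) hτT
    have h2 := h.hasDerivWithinAt_quartic s K hτT
    have h3 : HasDerivWithinAt (fun τ => (quartic s K n (v τ) τ).re) _ _ τ :=
      (Complex.reCLM.hasFDerivAt.comp_hasDerivWithinAt τ h2)
    refine ((h1.add (h3.const_mul (1 / 6))).congr_deriv ?_).mono
      (Set.Icc_subset_Icc_right ht.2)
    have hm : ∀ q : Fin 4 → ℤ, ∑ i, (q i : ℝ) * cutWeight s K (q i) = mult s K q := fun q =>
      Finset.sum_congr rfl fun i _ => mul_cutWeight s (by linarith) _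
    simp only [hm, Complex.reCLM_apply, Complex.add_re]
    ring
  have hb : ∀ τ ∈ Set.Icc (0 : ℝ) t, ‖(1 / 6) * (quarticRem s K n (v τ) τ).re‖ ≤
      C₂ * K ^ (-(1 / 6 : ℝ)) * R ^ 6 := by
    intro τ hτ
    have h1 := hb₂ n K R τ (v τ) (h.real τ) hK (by linarith) (hsob τ hτ)
    have h2 := Complex.abs_re_le_norm (quarticRem s K n (v τ) τ)
    rw [norm_mul, Real.norm_eq_abs, Real.norm_eq_abs, abs_of_nonneg (by norm_num : (0 : ℝ) ≤ 1 / 6)]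
    linarith [abs_nonneg (quarticRem s K n (v τ) τ).re]
  have key := (convex_Icc (0 : ℝ) t).norm_image_sub_le_of_norm_hasDerivWithin_le hd hb
    (Set.left_mem_Icc.2 ht.1) (Set.right_mem_Icc.2 ht.1)
  have hq : ∀ τ ∈ Set.Icc (0 : ℝ) t, |(quartic s K n (v τ) τ).re| ≤
      C₁ * K ^ (-(1 / 6 : ℝ)) * R ^ 6 := by
    intro τ hτ
    refine (Complex.abs_re_le_norm _).trans
      ((hb₁ n K R τ (v τ) hK (by linarith) (hsob τ hτ)).trans ?_)
    have : 0 ≤ K ^ (-(1 / 6 : ℝ)) := Real.rpow_nonneg (by linarith) _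
    gcongr
    norm_num
  have hq0 := abs_le.1 (hq 0 (Set.left_mem_Icc.2 ht.1))
  have hqt := abs_le.1 (hq t (Set.right_mem_Icc.2 ht.1))
  rw [sub_zero, Real.norm_of_nonneg ht.1] at key
  have key2 := (abs_le.1 key).2
  have hX : 0 ≤ K ^ (-(1 / 6 : ℝ)) * R ^ 6 :=
    mul_nonneg (Real.rpow_nonneg (by linarith) _) (by positivity)
  change E t ≤ E 0 + _
  have e1 := mul_nonneg hX ht.1
  have e2 := mul_nonneg hC₁ e1
  have e3 := mul_nonneg hC₂ hX
  have e4 := mul_nonneg hC₁ hX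
  nlinarith

lemma cutWeight_eq {s K : ℝ} (hs : 1 / 2 ≤ s) (hK : 0 ≤ K) (k : ℤ) :
    cutWeight s K k = max (|(k : ℝ)| - K) 0 ^ (2 * s + 1) / |(k : ℝ)| := by
  rcases le_total 0 (k : ℝ) with hk | hk
  · rw [cutWeight, oddCut_of_nonneg (by linarith) hK hk, abs_of_nonneg hk]
  · rw [← cutWeight_neg, cutWeight, Int.cast_neg,
      oddCut_of_nonneg (by linarith) hK (by linarith), abs_of_nonpos hk]

lemma cutWeight_nonneg {s K : ℝ} (hs : 1 / 2 ≤ s) (hK : 0 ≤ K) (k : ℤ) : 0 ≤ cutWeight s K k := by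
  rw [cutWeight_eq hs hK]
  positivity

lemma cutWeight_of_abs_le {s K : ℝ} {k : ℤ} (hk : |(k : ℝ)| ≤ K) : cutWeight s K k = 0 := by
  rw [cutWeight, oddCut_of_abs_le hk, zero_div]

lemma cutWeight_le {s K : ℝ} (hs : 1 / 2 ≤ s) (hK : 0 ≤ K) (k : ℤ) :
    cutWeight s K k ≤ jb k ^ (2 * s) := by
  have hj := Real.rpow_nonneg (jb_pos k).le (2 * s)
  rcases eq_or_ne k 0 with rfl | hk
  · rwa [cutWeight_of_abs_le (by simpa using hK)]
  · have hk' : 0 < |(k : ℝ)| := abs_pos.2 (by exact_mod_cast hk)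
    rw [cutWeight_eq hs hK, div_le_iff₀ hk']
    calc _ ≤ |(k : ℝ)| ^ (2 * s + 1) :=
          Real.rpow_le_rpow (le_max_right _ _) (max_le (by linarith) hk'.le) (by linarith)
      _ = |(k : ℝ)| ^ (2 * s) * |(k : ℝ)| := by rw [Real.rpow_add hk', Real.rpow_one]
      _ ≤ _ := by
        gcongr
        exact abs_le_jb k

lemma jb_rpow_le_cutWeight {s K : ℝ} (hs : 1 / 2 ≤ s) (hK : 1 ≤ K) {k : ℤ}
    (hk : 2 * K ≤ |(k : ℝ)|) : jb k ^ (2 * s) ≤ 2 ^ (4 * s + 1) * cutWeight s K k := by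
  have hk' : 0 < |(k : ℝ)| := by linarith
  rw [cutWeight_eq hs (by linarith), mul_div_assoc', le_div_iff₀ hk']
  calc jb k ^ (2 * s) * |(k : ℝ)| ≤ (2 * |(k : ℝ)|) ^ (2 * s) * |(k : ℝ)| := by
        gcongr
        · exact (jb_pos k).le
        · unfold jb
          linarith
    _ = 2 ^ (4 * s + 1) * (|(k : ℝ)| / 2) ^ (2 * s + 1) := by
        rw [Real.mul_rpow (by norm_num) hk'.le, Real.div_rpow hk'.le (by norm_num),
          mul_div_assoc', eq_div_iff (by positivity), Real.rpow_add hk', Real.rpow_one,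
          show 4 * s + 1 = 2 * s + (2 * s + 1) by ring, Real.rpow_add two_pos (2 * s) (2 * s + 1)]
        ring
    _ ≤ _ := by
        gcongr
        exact le_max_of_le_left (by linarith)

lemma sob_eq_sum {s : ℝ} {n : ℕ} {u : ℤ → ℂ} (hu : ∀ k ∉ freqs n, u k = 0) :
    sob s u = ENNReal.ofReal (∑ k ∈ freqs n, jb k ^ (2 * s) * ‖u k‖ ^ 2) := by
  rw [ENNReal.ofReal_sum_of_nonneg fun k _ =>
    mul_nonneg (Real.rpow_nonneg (jb_pos k).le _) (sq_nonneg _)]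
  refine tsum_eq_sum fun k hk => ?_
  rw [hu k hk]
  simp

lemma exists_norm_field_le : ∃ C : ℝ, 1 ≤ C ∧ ∀ (s t R : ℝ) (u : ℤ → ℂ), 1 / 2 ≤ s → 0 ≤ R →
    (∀ k, u (-k) = starRingEnd ℂ (u k)) → sob s u ≤ ENNReal.ofReal (R ^ 2) → ∀ k : ℤ,
      ‖Nonres u t k + Res u k‖ ≤ C * R ^ 3 * |(k : ℝ)| := by
  obtain ⟨C, hC, h⟩ := exists_conv3_envl_le
  refine ⟨2 * C, by linarith, fun s t R u hs hR hr hu k => ?_⟩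
  have h0 : 0 ≤ C * R ^ 3 := by positivity
  rw [← ENNReal.ofReal_le_ofReal_iff (by positivity), ofReal_norm]
  refine (enorm_Nonres_add_Res_le hr t k).trans ?_
  have h1 : conv3 (fun j => ‖u j‖ₑ) k ≤ ENNReal.ofReal (C * R ^ 3) :=
    (conv3_mono (enorm_le_envl hs u) k).trans (le_ofReal_of_tsum_sq_le h0 (h s u R hR hu) k)
  calc _ ≤ 2 * ENNReal.ofReal |(k : ℝ)| * ENNReal.ofReal (C * R ^ 3) := by gcongr
    _ = _ := by
      rw [show (2 : ℝ≥0∞) = ENNReal.ofReal 2 by norm_num, ← ENNReal.ofReal_mul (by norm_num),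
        ← ENNReal.ofReal_mul (by positivity)]
      congr 1
      ring

lemma IsGalerkin.norm_sub_le {n : ℕ} {T : ℝ} {v : ℝ → ℤ → ℂ} (h : IsGalerkin n T v) {t B : ℝ}
    (ht : t ≤ T) {k : ℤ}
    (hB : ∀ τ ∈ Set.Icc (0 : ℝ) t, ‖Nonres (v τ) τ k + Res (v τ) k‖ ≤ B) {a b : ℝ}
    (ha : a ∈ Set.Icc (0 : ℝ) t) (hb : b ∈ Set.Icc (0 : ℝ) t) :
    ‖v b k - v a k‖ ≤ B * |b - a| := by
  by_cases hk : k ∈ freqs n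
  · exact (convex_Icc (0 : ℝ) t).norm_image_sub_le_of_norm_hasDerivWithin_le (f := fun τ => v τ k)
      (fun τ hτ => (h.ode τ ⟨hτ.1, hτ.2.trans ht⟩ k hk).mono (Set.Icc_subset_Icc_right ht)) hB ha hb
  · rw [h.supp b k hk, h.supp a k hk, sub_zero, norm_zero]
    exact mul_nonneg ((norm_nonneg _).trans (hB a ha)) (abs_nonneg _)

lemma exists_high_bound {s : ℝ} (hs : 1 / 2 ≤ s) : ∃ C : ℝ, 1 ≤ C ∧
    ∀ (n : ℕ) (T : ℝ) (v : ℝ → ℤ → ℂ), IsGalerkin n T v → ∀ K R t : ℝ, 1 ≤ K → 1 ≤ R → t ≤ 1 →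
      t ∈ Set.Icc (0 : ℝ) T → (∀ τ ∈ Set.Icc (0 : ℝ) t, sob s (v τ) ≤ ENNReal.ofReal (R ^ 2)) →
      ∑ k ∈ freqs n with 2 * K ≤ |((k : ℤ) : ℝ)|, jb k ^ (2 * s) * ‖v t k‖ ^ 2 ≤
        C * (∑ k ∈ freqs n, cutWeight s K k * ‖v 0 k‖ ^ 2 + K ^ (-(1 / 6 : ℝ)) * R ^ 6) := by
  obtain ⟨C, hC, h⟩ := exists_energy_bound hs
  have h2 : (1 : ℝ) ≤ 2 ^ (4 * s + 1) := Real.one_le_rpow (by norm_num) (by linarith)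
  refine ⟨2 ^ (4 * s + 1) * (2 * C), by nlinarith, fun n T v hv K R t hK hR ht1 ht hsob => ?_⟩
  have hcw := cutWeight_nonneg hs (zero_le_one.trans hK)
  have hX : 0 ≤ K ^ (-(1 / 6 : ℝ)) * R ^ 6 :=
    mul_nonneg (Real.rpow_nonneg (by linarith) _) (by positivity)
  have hE0 : 0 ≤ ∑ k ∈ freqs n, cutWeight s K k * ‖v 0 k‖ ^ 2 :=
    Finset.sum_nonneg fun k _ => mul_nonneg (hcw k) (sq_nonneg _)
  calc _ ≤ ∑ k ∈ freqs n with 2 * K ≤ |((k : ℤ) : ℝ)|,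
        2 ^ (4 * s + 1) * (cutWeight s K k * ‖v t k‖ ^ 2) := by
        refine Finset.sum_le_sum fun k hk => ?_
        rw [← mul_assoc]
        gcongr
        exact jb_rpow_le_cutWeight hs hK (Finset.mem_filter.1 hk).2
    _ ≤ ∑ k ∈ freqs n, 2 ^ (4 * s + 1) * (cutWeight s K k * ‖v t k‖ ^ 2) :=
        Finset.sum_le_sum_of_subset_of_nonneg (Finset.filter_subset _ _) fun k _ _ =>
          mul_nonneg (by linarith) (mul_nonneg (hcw k) (sq_nonneg _))
    _ ≤ _ := by
        rw [← Finset.mul_sum, mul_assoc]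
        gcongr
        refine (h n T v hv K R t hK hR ht hsob).trans ?_
        have e1 : C * (K ^ (-(1 / 6 : ℝ)) * R ^ 6) * (1 + t) ≤
            C * (K ^ (-(1 / 6 : ℝ)) * R ^ 6) * 2 := by
          gcongr
          linarith
        nlinarith

lemma exists_apriori_step {s : ℝ} (hs : 1 / 2 ≤ s) : ∃ C : ℝ, 1 ≤ C ∧
    ∀ (n : ℕ) (T : ℝ) (v : ℝ → ℤ → ℂ), IsGalerkin n T v → ∀ K R t ν : ℝ, 1 ≤ K → 1 ≤ R → T ≤ 1 →
      t ∈ Set.Icc (0 : ℝ) T → (∀ τ ∈ Set.Icc (0 : ℝ) t, sob s (v τ) ≤ ENNReal.ofReal (R ^ 2)) →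
      ∑ k ∈ freqs n, jb k ^ (2 * s) * ‖v 0 k‖ ^ 2 ≤ ν ^ 2 →
      ∑ k ∈ freqs n, jb k ^ (2 * s) * ‖v t k‖ ^ 2 ≤
        C * (ν ^ 2 + K ^ (-(1 / 6 : ℝ)) * R ^ 6 + (3 * K) ^ (2 * s + 4) * R ^ 6 * T ^ 2) := by
  obtain ⟨C₁, hC₁, h₁⟩ := exists_high_bound hs
  obtain ⟨C₂, hC₂, h₂⟩ := exists_norm_field_le
  set S : ℝ := ∑' k : ℤ, jb k ^ (-(2 : ℝ)) with hS
  have hsum := summable_jb_rpow_neg (p := 2) (by norm_num)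
  have hjn : ∀ (k : ℤ) (p : ℝ), 0 ≤ jb k ^ p := fun k p => Real.rpow_nonneg (jb_pos k).le p
  have hS0 : 0 ≤ S := tsum_nonneg fun k => hjn k _
  refine ⟨C₁ + 2 + 2 * C₂ ^ 2 * S, by nlinarith [mul_nonneg (sq_nonneg C₂) hS0],
    fun n T v hv K R t ν hK hR hT ht hsob hν => ?_⟩
  have hhigh := h₁ n T v hv K R t hK hR (ht.2.trans hT) ht hsob
  have hcw : ∑ k ∈ freqs n, cutWeight s K k * ‖v 0 k‖ ^ 2 ≤ ν ^ 2 := by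
    refine le_trans (Finset.sum_le_sum fun k _ => ?_) hν
    gcongr
    exact cutWeight_le hs (by linarith) k
  have hlow : ∑ k ∈ freqs n with ¬ 2 * K ≤ |((k : ℤ) : ℝ)|, jb k ^ (2 * s) * ‖v t k‖ ^ 2 ≤
      2 * ν ^ 2 + 2 * C₂ ^ 2 * S * ((3 * K) ^ (2 * s + 4) * R ^ 6 * T ^ 2) := by
    have hterm : ∀ k : ℤ, ¬ 2 * K ≤ |(k : ℝ)| → jb k ^ (2 * s) * ‖v t k‖ ^ 2 ≤
        2 * (jb k ^ (2 * s) * ‖v 0 k‖ ^ 2) +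
          2 * C₂ ^ 2 * ((3 * K) ^ (2 * s + 4) * R ^ 6 * T ^ 2) * jb k ^ (-(2 : ℝ)) := by
      intro k hk
      have hd := hv.norm_sub_le ht.2
        (fun τ hτ => h₂ s τ R (v τ) hs (by linarith) (hv.real τ) (hsob τ hτ) k)
        (Set.left_mem_Icc.2 ht.1) (Set.right_mem_Icc.2 ht.1)
      rw [sub_zero, abs_of_nonneg ht.1] at hd
      have hd2 : ‖v t k - v 0 k‖ ≤ C₂ * R ^ 3 * jb k * T := by
        refine hd.trans ?_
        have := jb_pos k
        gcongr
        · exact ht.1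
        · exact abs_le_jb k
        · exact ht.2
      have h3 : ‖v t k‖ ≤ ‖v 0 k‖ + C₂ * R ^ 3 * jb k * T := by
        have := norm_le_norm_add_norm_sub' (v t k) (v 0 k)
        linarith
      have h4 : ‖v t k‖ ^ 2 ≤ 2 * ‖v 0 k‖ ^ 2 + 2 * (C₂ * R ^ 3 * jb k * T) ^ 2 := by
        have := pow_le_pow_left₀ (norm_nonneg _) h3 2
        nlinarith [sq_nonneg (‖v 0 k‖ - C₂ * R ^ 3 * jb k * T)]
      have h5 : jb k ^ (2 * s) * jb k ^ 2 ≤ (3 * K) ^ (2 * s + 4) * jb k ^ (-(2 : ℝ)) := by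
        have e : jb k ^ (2 * s) * jb k ^ 2 = jb k ^ (2 * s + 4) * jb k ^ (-(2 : ℝ)) := by
          rw [← Real.rpow_natCast (jb k) 2, ← Real.rpow_add (jb_pos k), ← Real.rpow_add (jb_pos k)]
          congr 1
          push_cast
          ring
        rw [e]
        refine mul_le_mul_of_nonneg_right (Real.rpow_le_rpow (jb_pos k).le ?_ (by linarith))
          (hjn k _)
        unfold jb
        linarith
      calc _ ≤ jb k ^ (2 * s) * (2 * ‖v 0 k‖ ^ 2 + 2 * (C₂ * R ^ 3 * jb k * T) ^ 2) :=
            mul_le_mul_of_nonneg_left h4 (hjn k _)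
        _ = 2 * (jb k ^ (2 * s) * ‖v 0 k‖ ^ 2) +
            2 * C₂ ^ 2 * R ^ 6 * T ^ 2 * (jb k ^ (2 * s) * jb k ^ 2) := by ring
        _ ≤ 2 * (jb k ^ (2 * s) * ‖v 0 k‖ ^ 2) +
            2 * C₂ ^ 2 * R ^ 6 * T ^ 2 * ((3 * K) ^ (2 * s + 4) * jb k ^ (-(2 : ℝ))) := by gcongr
        _ = _ := by ring
    calc _ ≤ ∑ k ∈ freqs n with ¬ 2 * K ≤ |((k : ℤ) : ℝ)|, (2 * (jb k ^ (2 * s) * ‖v 0 k‖ ^ 2) +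
          2 * C₂ ^ 2 * ((3 * K) ^ (2 * s + 4) * R ^ 6 * T ^ 2) * jb k ^ (-(2 : ℝ))) :=
          Finset.sum_le_sum fun k hk => hterm k (Finset.mem_filter.1 hk).2
      _ ≤ ∑ k ∈ freqs n, (2 * (jb k ^ (2 * s) * ‖v 0 k‖ ^ 2) +
          2 * C₂ ^ 2 * ((3 * K) ^ (2 * s + 4) * R ^ 6 * T ^ 2) * jb k ^ (-(2 : ℝ))) := by
          refine Finset.sum_le_sum_of_subset_of_nonneg (Finset.filter_subset _ _) fun k _ _ => ?_
          have := hjn k (2 * s)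
          have := hjn k (-(2 : ℝ))
          positivity
      _ ≤ _ := by
          rw [Finset.sum_add_distrib, ← Finset.mul_sum, ← Finset.mul_sum]
          have hSle : ∑ k ∈ freqs n, jb k ^ (-(2 : ℝ)) ≤ S :=
            hsum.sum_le_tsum _ fun k _ => hjn k _
          have hX : 0 ≤ 2 * C₂ ^ 2 * ((3 * K) ^ (2 * s + 4) * R ^ 6 * T ^ 2) := by positivity
          have := mul_le_mul_of_nonneg_left hSle hX
          linarith
  rw [← Finset.sum_filter_add_sum_filter_not (freqs n) fun k : ℤ => 2 * K ≤ |(k : ℝ)|]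
  have hX : 0 ≤ K ^ (-(1 / 6 : ℝ)) * R ^ 6 :=
    mul_nonneg (Real.rpow_nonneg (by linarith) _) (by positivity)
  have hY : 0 ≤ (3 * K) ^ (2 * s + 4) * R ^ 6 * T ^ 2 := by positivity
  have hZ : 0 ≤ 2 * C₂ ^ 2 * S := by positivity
  have e1 := mul_le_mul_of_nonneg_left hcw (by linarith : 0 ≤ C₁)
  have e2 := mul_nonneg hZ hX
  have e3 := mul_nonneg hZ (sq_nonneg ν)
  have e4 := mul_nonneg (by linarith : 0 ≤ C₁ + 2) hY
  nlinarith

/-- A continuity argument: a strictly improving bound propagates. -/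
lemma le_of_bootstrap {f : ℝ → ℝ} {T B B' : ℝ} (hf : ContinuousOn f (Set.Icc 0 T)) (h0 : f 0 ≤ B')
    (hB : B' < B)
    (h : ∀ t ∈ Set.Icc (0 : ℝ) T, (∀ τ ∈ Set.Icc (0 : ℝ) t, f τ ≤ B) → f t ≤ B') :
    ∀ t ∈ Set.Icc (0 : ℝ) T, f t ≤ B := by
  by_contra! hcon
  obtain ⟨t₀, ht₀, hlt⟩ := hcon
  have hcomp : IsCompact (Set.Icc (0 : ℝ) T ∩ f ⁻¹' Set.Ici B) :=
    isCompact_Icc.of_isClosed_subset (hf.preimage_isClosed_of_isClosed isClosed_Icc isClosed_Ici)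
      Set.inter_subset_left
  obtain ⟨t, ⟨ht, hBt⟩, hmin⟩ := hcomp.exists_isLeast ⟨t₀, ht₀, hlt.le⟩
  have hBt' : B ≤ f t := hBt
  refine (hB.trans_le hBt').not_ge (h t ht fun τ hτ => ?_)
  by_contra! hτB
  obtain ⟨r, hr, hfr⟩ := intermediate_value_Icc hτ.1
    (hf.mono (Set.Icc_subset_Icc_right (hτ.2.trans ht.2)))
    (⟨(h0.trans hB.le), hτB.le⟩ : B ∈ Set.Icc (f 0) (f τ))
  have h1 := hmin ⟨⟨hr.1, hr.2.trans (hτ.2.trans ht.2)⟩, hfr.ge⟩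
  have h2 : r = τ := le_antisymm hr.2 (hτ.2.trans h1)
  rw [← hfr, h2] at hτB
  exact lt_irrefl _ hτB

lemma IsGalerkin.continuousOn_sum {n : ℕ} {T : ℝ} {v : ℝ → ℤ → ℂ} (h : IsGalerkin n T v) (W : ℤ → ℝ) :
    ContinuousOn (fun τ => ∑ k ∈ freqs n, W k * ‖v τ k‖ ^ 2) (Set.Icc (0 : ℝ) T) := by
  refine continuousOn_finsetSum _ fun k hk => ContinuousOn.mul continuousOn_const ?_
  exact ContinuousOn.pow (ContinuousOn.norm fun t ht => (h.ode t ht k hk).continuousWithinAt) 2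

/-- Uniform bounds for the truncated solutions on a time interval of controlled length. -/
lemma exists_apriori {s : ℝ} (hs : 1 / 2 ≤ s) : ∃ c > (0 : ℝ), ∃ β > (0 : ℝ), ∀ ν : ℝ, 0 ≤ ν →
    ∃ T R : ℝ, c * (1 + ν) ^ (-β) = T ∧ 0 < T ∧ T ≤ 1 ∧ 1 ≤ R ∧
      ∀ (n : ℕ) (v : ℝ → ℤ → ℂ), IsGalerkin n T v →
        ∑ k ∈ freqs n, jb k ^ (2 * s) * ‖v 0 k‖ ^ 2 ≤ ν ^ 2 →
        ∀ t ∈ Set.Icc (0 : ℝ) T, sob s (v t) ≤ ENNReal.ofReal (R ^ 2) := by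
  obtain ⟨C, hC, h⟩ := exists_apriori_step hs
  have hC0 : 0 < C := by linarith
  refine ⟨(2 * C * (3 ^ (s + 2) * (4 * C) ^ (6 * (s + 2))) * (2 * C) ^ (24 * (s + 2) + 2))⁻¹,
    by positivity, 24 * (s + 2) + 2, by linarith, fun ν hν => ?_⟩
  set R : ℝ := 2 * C * (1 + ν) with hR
  have hR1 : 1 ≤ R := by nlinarith
  have hR0 : 0 < R := by linarith
  set K : ℝ := (4 * C * R ^ 4) ^ 6 with hK
  have hK0 : 1 ≤ 4 * C * R ^ 4 := by nlinarith [one_le_pow₀ hR1 (n := 4)]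
  have hK1 : 1 ≤ K := one_le_pow₀ hK0
  have hK16 : K ^ (-(1 / 6 : ℝ)) = (4 * C * R ^ 4)⁻¹ := by
    rw [hK, ← Real.rpow_natCast _ 6, ← Real.rpow_mul (by linarith)]
    rw [show ((6 : ℕ) : ℝ) * -(1 / 6) = -1 by norm_num, Real.rpow_neg_one]
  set L := (3 * K) ^ (s + 2) with hL
  have hL1 : 1 ≤ L := Real.one_le_rpow (by linarith) (by linarith)
  have hL2 : (3 * K) ^ (2 * s + 4) = L ^ 2 := by
    rw [hL, ← Real.rpow_natCast _ 2, ← Real.rpow_mul (by linarith)]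
    congr 1
    push_cast
    ring
  have hLeq : L = 3 ^ (s + 2) * (4 * C) ^ (6 * (s + 2)) * R ^ (24 * (s + 2)) := by
    rw [hL, hK, Real.mul_rpow (by norm_num) (by positivity), ← Real.rpow_natCast _ 6,
      ← Real.rpow_mul (by positivity), Real.mul_rpow (by positivity) (by positivity),
      ← Real.rpow_natCast R 4, ← Real.rpow_mul hR0.le, mul_assoc]
    congr 3
    push_cast
    ring
  set T := (2 * C * L * R ^ 2)⁻¹ with hT
  have hD : 1 ≤ 2 * C * L * R ^ 2 := by
    have := one_le_pow₀ hR1 (n := 2)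
    have : 1 ≤ 2 * C * L := by nlinarith
    nlinarith
  refine ⟨T, R, ?_, by positivity, inv_le_one_of_one_le₀ hD, hR1, fun n v hv hv0 t ht => ?_⟩
  · rw [hT, Real.rpow_neg (by linarith), ← mul_inv, hLeq]
    congr 1
    have : R ^ (24 * (s + 2)) * R ^ 2 = (2 * C) ^ (24 * (s + 2) + 2) * (1 + ν) ^ (24 * (s + 2) + 2) := by
      rw [← Real.mul_rpow (by linarith) (by linarith), ← hR, Real.rpow_add hR0]
      norm_num
    linear_combination (-2 * C * 3 ^ (s + 2) * (4 * C) ^ (6 * (s + 2))) * this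
  · rw [sob_eq_sum (hv.supp t)]
    refine ENNReal.ofReal_le_ofReal ?_
    refine le_of_bootstrap (B' := 3 / 4 * R ^ 2)
      (hv.continuousOn_sum fun k => jb k ^ (2 * s)) ?_ (by nlinarith) ?_ t ht
    · refine hv0.trans ?_
      have : ν ≤ R / 2 := by nlinarith
      nlinarith
    · intro t ht hB
      refine (h n T v hv K R t ν hK1 hR1 (inv_le_one_of_one_le₀ hD) ht (fun τ hτ => ?_) hv0).trans ?_
      · rw [sob_eq_sum (hv.supp τ)]
        exact ENNReal.ofReal_le_ofReal (hB τ hτ)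
      · rw [hK16, hL2]
        have e1 : C * ν ^ 2 ≤ R ^ 2 / 4 := by
          rw [hR]
          have : ν ^ 2 ≤ (1 + ν) ^ 2 := by nlinarith
          have h2 : C * ν ^ 2 ≤ C ^ 2 * (1 + ν) ^ 2 := by
            refine mul_le_mul (by nlinarith) this (sq_nonneg _) (sq_nonneg _)
          nlinarith
        have e2 : C * ((4 * C * R ^ 4)⁻¹ * R ^ 6) = R ^ 2 / 4 := by
          field_simp
        have e3 : C * (L ^ 2 * R ^ 6 * T ^ 2) ≤ R ^ 2 / 4 := by
          have : C * (L ^ 2 * R ^ 6 * T ^ 2) = R ^ 2 / (4 * C) := by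
            rw [hT]
            field_simp
            ring
          rw [this]
          gcongr
          linarith
        linarith

lemma norm_le_of_sob_le {s R : ℝ} {u : ℤ → ℂ} (hs : 0 ≤ s) (hR : 0 ≤ R)
    (h : sob s u ≤ ENNReal.ofReal (R ^ 2)) (k : ℤ) : ‖u k‖ ≤ R := by
  have h1 : ENNReal.ofReal (jb k ^ (2 * s) * ‖u k‖ ^ 2) ≤ ENNReal.ofReal (R ^ 2) :=
    (ENNReal.le_tsum (f := fun k : ℤ => ENNReal.ofReal (jb k ^ (2 * s) * ‖u k‖ ^ 2)) k).trans h
  rw [ENNReal.ofReal_le_ofReal_iff (sq_nonneg R)] at h1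
  have h2 : 1 ≤ jb k ^ (2 * s) := Real.one_le_rpow (one_le_jb k) (by linarith)
  refine (pow_le_pow_iff_left₀ (norm_nonneg _) hR two_ne_zero).1 (le_trans ?_ h1)
  exact le_mul_of_one_le_left (sq_nonneg _) h2

lemma sob_le_iff {s B : ℝ} (hB : 0 ≤ B) (u : ℤ → ℂ) : sob s u ≤ ENNReal.ofReal B ↔
    ∀ S : Finset ℤ, ∑ k ∈ S, jb k ^ (2 * s) * ‖u k‖ ^ 2 ≤ B := by
  rw [sob, ENNReal.tsum_eq_iSup_sum, iSup_le_iff]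
  refine forall_congr' fun S => ?_
  rw [← ENNReal.ofReal_sum_of_nonneg fun k _ =>
    mul_nonneg (Real.rpow_nonneg (jb_pos k).le _) (sq_nonneg _), ENNReal.ofReal_le_ofReal_iff hB]

lemma exists_tsum_enorm_ntermF_le : ∃ C : ℝ, 1 ≤ C ∧ ∀ (s R t : ℝ) (u : ℤ → ℂ), 1 / 2 ≤ s →
    0 ≤ R → sob s u ≤ ENNReal.ofReal (R ^ 2) → ∀ k : ℤ,
      ∑' p, ‖ntermF u t k p‖ₑ ≤ ENNReal.ofReal (C * R ^ 3 * |(k : ℝ)|) := by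
  obtain ⟨C, hC, h⟩ := exists_conv3_envl_le
  refine ⟨C, hC, fun s R t u hs hR hu k => ?_⟩
  have h0 : 0 ≤ C * R ^ 3 := by positivity
  calc _ ≤ ∑' p : ℤ × ℤ,
        ENNReal.ofReal |(k : ℝ)| * (‖u p.1‖ₑ * ‖u p.2‖ₑ * ‖u (k - p.1 - p.2)‖ₑ) :=
        ENNReal.tsum_le_tsum fun p => enorm_ntermF_le u t k p
    _ = ENNReal.ofReal |(k : ℝ)| * conv3 (fun j => ‖u j‖ₑ) k := by rw [ENNReal.tsum_mul_left, conv3]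
    _ ≤ ENNReal.ofReal |(k : ℝ)| * ENNReal.ofReal (C * R ^ 3) := by
        gcongr
        exact (conv3_mono (enorm_le_envl hs u) k).trans (le_ofReal_of_tsum_sq_le h0 (h s u R hR hu) k)
    _ = _ := by rw [← ENNReal.ofReal_mul (abs_nonneg _), mul_comm]

lemma summable_norm_ntermF {s R : ℝ} (hs : 1 / 2 ≤ s) (hR : 0 ≤ R) {u : ℤ → ℂ}
    (hu : sob s u ≤ ENNReal.ofReal (R ^ 2)) (t : ℝ) (k : ℤ) :
    Summable fun p => ‖ntermF u t k p‖ := by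
  obtain ⟨C, -, h⟩ := exists_tsum_enorm_ntermF_le
  have h1 : ∑' p, ‖ntermF u t k p‖ₑ ≠ ⊤ := ne_top_of_le_ne_top ENNReal.ofReal_ne_top (h s R t u hs hR hu k)
  have h2 := ENNReal.summable_toReal h1
  simpa using h2

lemma enorm_le_mul_envl {s L : ℝ} (hs : 1 / 2 ≤ s) (hL : 0 < L) (u : ℤ → ℂ) {k : ℤ}
    (hk : L ≤ |(k : ℝ)|) : ‖u k‖ₑ ≤ ENNReal.ofReal (L ^ (-(1 / 12 : ℝ))) * envl s u k := by
  have hLp : 0 ≤ L ^ (-(1 / 12 : ℝ)) := Real.rpow_nonneg hL.le _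
  rw [envl, ← ENNReal.ofReal_mul hLp, ← ofReal_norm]
  refine ENNReal.ofReal_le_ofReal ?_
  rw [← mul_assoc]
  refine le_mul_of_one_le_left (norm_nonneg _) ?_
  calc (1 : ℝ) = L ^ (-(1 / 12 : ℝ)) * L ^ (1 / 12 : ℝ) := by
        rw [← Real.rpow_add hL]
        norm_num
    _ ≤ L ^ (-(1 / 12 : ℝ)) * jb k ^ (1 / 12 : ℝ) := by
        gcongr
        exact hk.trans (abs_le_jb k)
    _ ≤ _ := by
        gcongr
        · exact one_le_jb k
        · linarith

lemma exists_finset_Nonres {s R ε : ℝ} (hs : 1 / 2 ≤ s) (hR : 0 ≤ R) (hε : 0 < ε) (k : ℤ) :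
    ∃ S : Finset (ℤ × ℤ), ∀ (u : ℤ → ℂ) (t : ℝ), sob s u ≤ ENNReal.ofReal (R ^ 2) →
      ‖Nonres u t k - Complex.I / 3 * ∑ p ∈ S, ntermF u t k p‖ ≤ ε := by
  obtain ⟨C, hC, h⟩ := exists_conv3_envl_le
  have hlim : Filter.Tendsto (fun n : ℕ => |(k : ℝ)| * (((n : ℝ) + 1) ^ (-(1 / 12 : ℝ)) * (C * R ^ 3)))
      Filter.atTop (nhds 0) := by
    have h1 : Filter.Tendsto (fun n : ℕ => ((n : ℝ) + 1) ^ (-(1 / 12 : ℝ))) Filter.atTop (nhds 0) :=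
      (tendsto_rpow_neg_atTop (by norm_num)).comp
        (Filter.tendsto_atTop_add_const_right _ 1 tendsto_natCast_atTop_atTop)
    simpa using (h1.mul_const (C * R ^ 3)).const_mul |(k : ℝ)|
  obtain ⟨n, hn⟩ := (hlim.eventually (gt_mem_nhds hε)).exists
  refine ⟨freqs n ×ˢ freqs n, fun u t hu => ?_⟩
  have h0 : 0 ≤ C * R ^ 3 := by positivity
  have hL : (0 : ℝ) < (n : ℝ) + 1 := by positivity
  have hLp : 0 ≤ ((n : ℝ) + 1) ^ (-(1 / 12 : ℝ)) := Real.rpow_nonneg hL.le _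
  have hsum : Summable (ntermF u t k) := (summable_norm_ntermF hs hR hu t k).of_norm
  have hbig : ∀ j ∉ freqs n, ‖u j‖ₑ ≤ ENNReal.ofReal (((n : ℝ) + 1) ^ (-(1 / 12 : ℝ))) * envl s u j := by
    intro j hj
    refine enorm_le_mul_envl hs hL u ?_
    rw [mem_freqs, not_le] at hj
    have : (n : ℤ) + 1 ≤ |j| := hj
    exact_mod_cast this
  have hterm : ∀ p ∉ freqs n ×ˢ freqs n, ‖ntermF u t k p‖ₑ ≤ ENNReal.ofReal |(k : ℝ)| *
      (ENNReal.ofReal (((n : ℝ) + 1) ^ (-(1 / 12 : ℝ))) *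
        (envl s u p.1 * envl s u p.2 * envl s u (k - p.1 - p.2))) := by
    intro p hp
    refine (enorm_ntermF_le u t k p).trans (mul_le_mul_right ?_ _)
    have e := enorm_le_envl hs u
    rw [Finset.mem_product, not_and_or] at hp
    rcases hp with hp | hp
    · refine (mul_le_mul' (mul_le_mul' (hbig _ hp) (e p.2)) (e (k - p.1 - p.2))).trans_eq ?_
      ring
    · refine (mul_le_mul' (mul_le_mul' (e p.1) (hbig _ hp)) (e (k - p.1 - p.2))).trans_eq ?_
      ring
  have h13 : ‖Complex.I / 3‖ ≤ 1 := by
    simp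
    norm_num
  rw [Nonres, ← hsum.sum_add_tsum_subtype_compl (freqs n ×ˢ freqs n), mul_add, add_sub_cancel_left,
    norm_mul]
  refine (mul_le_of_le_one_left (norm_nonneg _) h13).trans ?_
  rw [← ENNReal.ofReal_le_ofReal_iff hε.le, ofReal_norm]
  calc _ ≤ ∑' p : {p // p ∉ freqs n ×ˢ freqs n}, ‖ntermF u t k p‖ₑ := enorm_tsum_le_tsum_enorm
    _ ≤ ∑' p : {p // p ∉ freqs n ×ˢ freqs n}, ENNReal.ofReal |(k : ℝ)| *
      (ENNReal.ofReal (((n : ℝ) + 1) ^ (-(1 / 12 : ℝ))) *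
        (envl s u p.1.1 * envl s u p.1.2 * envl s u (k - p.1.1 - p.1.2))) :=
        ENNReal.tsum_le_tsum fun p => hterm p.1 p.2
    _ ≤ ∑' p : ℤ × ℤ, ENNReal.ofReal |(k : ℝ)| *
      (ENNReal.ofReal (((n : ℝ) + 1) ^ (-(1 / 12 : ℝ))) *
        (envl s u p.1 * envl s u p.2 * envl s u (k - p.1 - p.2))) :=
        ENNReal.tsum_comp_le_tsum_of_injective Subtype.val_injective _
    _ = ENNReal.ofReal |(k : ℝ)| * (ENNReal.ofReal (((n : ℝ) + 1) ^ (-(1 / 12 : ℝ))) *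
        conv3 (envl s u) k) := by
        rw [ENNReal.tsum_mul_left, ENNReal.tsum_mul_left, conv3]
    _ ≤ ENNReal.ofReal |(k : ℝ)| * (ENNReal.ofReal (((n : ℝ) + 1) ^ (-(1 / 12 : ℝ))) *
        ENNReal.ofReal (C * R ^ 3)) := by
        gcongr
        exact le_ofReal_of_tsum_sq_le h0 (h s u R hR hu) k
    _ ≤ ENNReal.ofReal ε := by
        rw [← ENNReal.ofReal_mul hLp, ← ENNReal.ofReal_mul (abs_nonneg _)]
        exact ENNReal.ofReal_le_ofReal hn.le

lemma norm_mul_sub_mul_le {R : ℝ} (hR : 1 ≤ R) {e e' x x' y y' z z' : ℂ} (he : ‖e‖ ≤ 1)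
    (hx : ‖x‖ ≤ R) (hx' : ‖x'‖ ≤ R) (hy : ‖y‖ ≤ R) (hy' : ‖y'‖ ≤ R) (hz' : ‖z'‖ ≤ R) :
    ‖e * x * y * z - e' * x' * y' * z'‖ ≤
      R ^ 3 * (‖e - e'‖ + ‖x - x'‖ + ‖y - y'‖ + ‖z - z'‖) := by
  have h1 : e * x * y * z - e' * x' * y' * z' = (e - e') * (x' * y' * z') +
      e * (x - x') * (y' * z') + e * x * (y - y') * z' + e * x * y * (z - z') := by ring
  have hR2 : R * R ≤ R ^ 3 := by nlinarith
  have e1 : ‖(e - e') * (x' * y' * z')‖ ≤ ‖e - e'‖ * R ^ 3 := by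
    rw [norm_mul, norm_mul, norm_mul]
    calc _ ≤ ‖e - e'‖ * (R * R * R) := by gcongr
      _ = _ := by ring
  have e2 : ‖e * (x - x') * (y' * z')‖ ≤ ‖x - x'‖ * R ^ 3 := by
    rw [norm_mul, norm_mul, norm_mul]
    calc _ ≤ 1 * ‖x - x'‖ * (R * R) := by gcongr
      _ ≤ 1 * ‖x - x'‖ * R ^ 3 := by gcongr
      _ = _ := by ring
  have e3 : ‖e * x * (y - y') * z'‖ ≤ ‖y - y'‖ * R ^ 3 := by
    rw [norm_mul, norm_mul, norm_mul]
    calc _ ≤ 1 * R * ‖y - y'‖ * R := by gcongr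
      _ = ‖y - y'‖ * (R * R) := by ring
      _ ≤ _ := by gcongr
  have e4 : ‖e * x * y * (z - z')‖ ≤ ‖z - z'‖ * R ^ 3 := by
    rw [norm_mul, norm_mul, norm_mul]
    calc _ ≤ 1 * R * R * ‖z - z'‖ := by gcongr
      _ = ‖z - z'‖ * (R * R) := by ring
      _ ≤ _ := by gcongr
  rw [h1]
  calc _ ≤ _ := norm_add₄_le
    _ ≤ _ := add_le_add (add_le_add (add_le_add e1 e2) e3) e4
    _ = _ := by ring

lemma norm_exp_sub_exp_le (t t' : ℝ) (m : ℤ) :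
    ‖Complex.exp (Complex.I * t * (m : ℤ)) - Complex.exp (Complex.I * t' * (m : ℤ))‖ ≤
      |(m : ℝ)| * |t - t'| := by
  have h1 : Complex.exp (Complex.I * t * (m : ℤ)) - Complex.exp (Complex.I * t' * (m : ℤ)) =
      Complex.exp (Complex.I * t' * (m : ℤ)) *
        (Complex.exp (Complex.I * ((m * (t - t') : ℝ) : ℂ)) - 1) := by
    rw [mul_sub, ← Complex.exp_add, mul_one]
    congr 2
    push_cast
    ring
  have h2 : ‖Complex.exp (Complex.I * t' * (m : ℤ))‖ = 1 := by
    rw [Complex.norm_exp]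
    simp
  rw [h1, norm_mul, h2, one_mul, ← abs_mul, ← Real.norm_eq_abs]
  exact Real.norm_exp_I_mul_ofReal_sub_one_le

lemma exists_equicontinuity {s R ε : ℝ} (hs : 1 / 2 ≤ s) (hR : 1 ≤ R) (hε : 0 < ε) (B : ℝ)
    (k : ℤ) : ∃ M : ℝ, ∀ (u u' : ℤ → ℂ) (t t' : ℝ), sob s u ≤ ENNReal.ofReal (R ^ 2) →
      sob s u' ≤ ENNReal.ofReal (R ^ 2) → (∀ j : ℤ, ‖u j - u' j‖ ≤ B * |(j : ℝ)| * |t - t'|) →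
      ‖(Nonres u t k + Res u k) - (Nonres u' t' k + Res u' k)‖ ≤ ε + M * |t - t'| := by
  have hR0 : 0 ≤ R := by linarith
  obtain ⟨S, hS⟩ := exists_finset_Nonres hs hR0 (half_pos hε) k
  set A : ℤ × ℤ → ℝ := fun p => |(k : ℝ)| * (R ^ 3 * (|(Phi p.1 p.2 (k - p.1 - p.2) : ℝ)| +
    B * |(p.1 : ℝ)| + B * |(p.2 : ℝ)| + B * |((k - p.1 - p.2 : ℤ) : ℝ)|)) with hA
  refine ⟨∑ p ∈ S, A p + |(k : ℝ)| * (R ^ 3 * (3 * (B * |(k : ℝ)|))),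
    fun u u' t t' hu hu' hd => ?_⟩
  have hb := norm_le_of_sob_le (by linarith) hR0 hu
  have hb' := norm_le_of_sob_le (by linarith) hR0 hu'
  have hpos : ∀ j : ℤ, 0 ≤ B * |(j : ℝ)| * |t - t'| := fun j => (norm_nonneg _).trans (hd j)
  have hterm : ∀ p, ‖ntermF u t k p - ntermF u' t' k p‖ ≤ A p * |t - t'| := by
    intro p
    unfold ntermF
    split_ifs with hP
    · have h1 := norm_mul_sub_mul_le hR (e := Complex.exp (Complex.I * (t : ℂ) *
          ((Phi p.1 p.2 (k - p.1 - p.2) : ℤ) : ℂ))) (e' := Complex.exp (Complex.I * (t' : ℂ) *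
          ((Phi p.1 p.2 (k - p.1 - p.2) : ℤ) : ℂ))) (z := u (k - p.1 - p.2)) (by rw [Complex.norm_exp]; simp)
          (hb p.1) (hb' p.1) (hb p.2) (hb' p.2) (hb' (k - p.1 - p.2))
      have h2 := norm_exp_sub_exp_le t t' (Phi p.1 p.2 (k - p.1 - p.2))
      have h3 : ∀ e x y z e' x' y' z' : ℂ, (k : ℂ) * e * x * y * z - (k : ℂ) * e' * x' * y' * z' =
          k * (e * x * y * z - e' * x' * y' * z') := by intros; ring
      rw [h3, norm_mul, Complex.norm_intCast]
      calc _ ≤ |(k : ℝ)| * (R ^ 3 * (|(Phi p.1 p.2 (k - p.1 - p.2) : ℝ)| * |t - t'| +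
            B * |(p.1 : ℝ)| * |t - t'| + B * |(p.2 : ℝ)| * |t - t'| +
            B * |((k - p.1 - p.2 : ℤ) : ℝ)| * |t - t'|)) := by
            refine mul_le_mul_of_nonneg_left (h1.trans ?_) (abs_nonneg _)
            gcongr
            exacts [hd _, hd _, hd _]
        _ = _ := by
            rw [hA]
            ring
    · have hx := hpos p.1
      have hy := hpos p.2
      have hz := hpos (k - p.1 - p.2)
      have : A p * |t - t'| = |(k : ℝ)| * (R ^ 3 * (|(Phi p.1 p.2 (k - p.1 - p.2) : ℝ)| * |t - t'| +
            B * |(p.1 : ℝ)| * |t - t'| + B * |(p.2 : ℝ)| * |t - t'| +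
            B * |((k - p.1 - p.2 : ℤ) : ℝ)| * |t - t'|)) := by
        rw [hA]
        ring
      rw [sub_self, norm_zero, this]
      positivity
  have hfin : ‖Complex.I / 3 * ∑ p ∈ S, ntermF u t k p - Complex.I / 3 * ∑ p ∈ S, ntermF u' t' k p‖ ≤
      (∑ p ∈ S, A p) * |t - t'| := by
    have h13 : ‖Complex.I / 3‖ ≤ 1 := by
      simp
      norm_num
    rw [← mul_sub, ← Finset.sum_sub_distrib, norm_mul, Finset.sum_mul]
    exact (mul_le_of_le_one_left (norm_nonneg _) h13).trans
      ((norm_sum_le _ _).trans (Finset.sum_le_sum fun p _ => hterm p))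
  have hres : ‖Res u k - Res u' k‖ ≤ |(k : ℝ)| * (R ^ 3 * (3 * (B * |(k : ℝ)|))) * |t - t'| := by
    have hn : ∀ x : ℂ, ‖((‖x‖ : ℝ) : ℂ)‖ = ‖x‖ := fun x => by rw [Complex.norm_real, norm_norm]
    have h1 := norm_mul_sub_mul_le hR (e := 1) (e' := 1) (z := u k) (by simp) ((hn _).trans_le (hb k))
      ((hn _).trans_le (hb' k)) ((hn _).trans_le (hb k)) ((hn _).trans_le (hb' k)) (hb' k)
    have h2 : ‖((‖u k‖ : ℝ) : ℂ) - ((‖u' k‖ : ℝ) : ℂ)‖ ≤ ‖u k - u' k‖ := by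
      rw [← Complex.ofReal_sub, Complex.norm_real, Real.norm_eq_abs]
      exact abs_norm_sub_norm_le _ _
    have h3 : Res u k - Res u' k = -Complex.I * k * (1 * (‖u k‖ : ℂ) * ‖u k‖ * u k -
        1 * (‖u' k‖ : ℂ) * ‖u' k‖ * u' k) := by
      unfold Res
      ring
    rw [h3, norm_mul, norm_mul, norm_neg, Complex.norm_I, one_mul, Complex.norm_intCast]
    calc _ ≤ |(k : ℝ)| * (R ^ 3 * (3 * (B * |(k : ℝ)| * |t - t'|))) := by
          refine mul_le_mul_of_nonneg_left (h1.trans ?_) (abs_nonneg _)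
          rw [sub_self, norm_zero]
          have := hd k
          gcongr
          linarith
      _ = _ := by ring
  have h1 := hS u t hu
  have h2 := hS u' t' hu'
  rw [norm_sub_rev] at h2
  have hsplit : (Nonres u t k + Res u k) - (Nonres u' t' k + Res u' k) =
      (Nonres u t k - Complex.I / 3 * ∑ p ∈ S, ntermF u t k p) +
      (Complex.I / 3 * ∑ p ∈ S, ntermF u' t' k p - Nonres u' t' k) +
      (Complex.I / 3 * ∑ p ∈ S, ntermF u t k p - Complex.I / 3 * ∑ p ∈ S, ntermF u' t' k p) +
      (Res u k - Res u' k) := by ring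
  rw [hsplit]
  refine norm_add₄_le.trans ?_
  linarith

lemma tendsto_field {ι : Type*} {l : Filter ι} {s R : ℝ} (hs : 1 / 2 ≤ s) (hR : 0 ≤ R)
    {u : ι → ℤ → ℂ} {w : ℤ → ℂ} (hu : ∀ i, sob s (u i) ≤ ENNReal.ofReal (R ^ 2))
    (hw : sob s w ≤ ENNReal.ofReal (R ^ 2))
    (h : ∀ k, Filter.Tendsto (fun i => u i k) l (nhds (w k))) (t : ℝ) (k : ℤ) :
    Filter.Tendsto (fun i => Nonres (u i) t k + Res (u i) k) l (nhds (Nonres w t k + Res w k)) := by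
  refine Filter.Tendsto.add ?_ ?_
  · rw [Metric.tendsto_nhds]
    intro ε hε
    obtain ⟨S, hS⟩ := exists_finset_Nonres hs hR (by positivity : 0 < ε / 4) k
    have hterm : ∀ p, Filter.Tendsto (fun i => ntermF (u i) t k p) l (nhds (ntermF w t k p)) := by
      intro p
      unfold ntermF
      split_ifs
      · exact ((tendsto_const_nhds.mul (h _)).mul (h _)).mul (h _)
      · exact tendsto_const_nhds
    have hfin : Filter.Tendsto (fun i => Complex.I / 3 * ∑ p ∈ S, ntermF (u i) t k p) l
        (nhds (Complex.I / 3 * ∑ p ∈ S, ntermF w t k p)) :=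
      tendsto_const_nhds.mul (tendsto_finsetSum _ fun p _ => hterm p)
    filter_upwards [Metric.tendsto_nhds.1 hfin (ε / 4) (by positivity)] with i hi
    have h1 := hS (u i) t (hu i)
    have h2 := hS w t hw
    rw [dist_eq_norm] at hi ⊢
    rw [norm_sub_rev] at h2
    have hsplit : Nonres (u i) t k - Nonres w t k =
        (Nonres (u i) t k - Complex.I / 3 * ∑ p ∈ S, ntermF (u i) t k p) +
        (Complex.I / 3 * ∑ p ∈ S, ntermF (u i) t k p - Complex.I / 3 * ∑ p ∈ S, ntermF w t k p) +
        (Complex.I / 3 * ∑ p ∈ S, ntermF w t k p - Nonres w t k) := by ring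
    rw [hsplit]
    refine norm_add₃_le.trans_lt ?_
    linarith
  · unfold Res
    refine Filter.Tendsto.mul (tendsto_const_nhds.mul (Filter.Tendsto.pow ?_ 2)) (h k)
    exact (Complex.continuous_ofReal.tendsto _).comp (h k).norm

lemma exists_uniform_tail {s : ℝ} (hs : 1 / 2 ≤ s) {u : ℤ → ℂ} (hu : sob s u ≠ ⊤) {T R : ℝ}
    (hT : T ≤ 1) (hR : 1 ≤ R) {v : ℕ → ℝ → ℤ → ℂ} (hv : ∀ n, IsGalerkin n T (v n))
    (h0 : ∀ n, ∀ k ∈ freqs n, v n 0 k = u k)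
    (hsob : ∀ n, ∀ t ∈ Set.Icc 0 T, sob s (v n t) ≤ ENNReal.ofReal (R ^ 2)) {ε : ℝ} (hε : 0 < ε) :
    ∃ L : ℝ, ∀ n, ∀ t ∈ Set.Icc 0 T, ∀ F : Finset ℤ, (∀ k ∈ F, L ≤ |(k : ℝ)|) →
      ∑ k ∈ F, jb k ^ (2 * s) * ‖v n t k‖ ^ 2 ≤ ε := by
  obtain ⟨C, hC, h⟩ := exists_high_bound hs
  have hC0 : 0 < C := by linarith
  have hpos : ∀ (f : ℤ → ℂ) k, 0 ≤ jb k ^ (2 * s) * ‖f k‖ ^ 2 := fun f k =>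
    mul_nonneg (Real.rpow_nonneg (jb_pos k).le _) (sq_nonneg _)
  have hsum : Summable fun k => jb k ^ (2 * s) * ‖u k‖ ^ 2 := by
    refine (ENNReal.summable_toReal hu).congr fun k => ENNReal.toReal_ofReal (hpos u k)
  obtain ⟨S, hS⟩ := summable_iff_vanishing_norm.1 hsum (ε / (2 * C)) (by positivity)
  have hlim : Filter.Tendsto (fun K : ℝ => K ^ (-(1 / 6 : ℝ)) * R ^ 6) Filter.atTop (nhds 0) := by
    simpa using (tendsto_rpow_neg_atTop (by norm_num : (0 : ℝ) < 1 / 6)).mul_const (R ^ 6)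
  obtain ⟨K, hK1, hKS, hKR⟩ := ((Filter.eventually_ge_atTop (1 : ℝ)).and
    (((Filter.eventually_all_finset S).2 fun k _ => Filter.eventually_ge_atTop |(k : ℝ)|).and
      (hlim.eventually (gt_mem_nhds (by positivity : 0 < ε / (2 * C)))))).exists
  refine ⟨2 * K, fun n t ht F hF => ?_⟩
  have hcut : ∑ k ∈ freqs n, cutWeight s K k * ‖v n 0 k‖ ^ 2 ≤ ε / (2 * C) := by
    calc _ ≤ ∑ k ∈ freqs n with K < |((k : ℤ) : ℝ)|, jb k ^ (2 * s) * ‖u k‖ ^ 2 := by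
          rw [Finset.sum_filter]
          refine Finset.sum_le_sum fun k hk => ?_
          rw [h0 n k hk]
          split_ifs with hlt
          · exact mul_le_mul_of_nonneg_right (cutWeight_le hs (by linarith) k) (sq_nonneg _)
          · rw [cutWeight_of_abs_le (not_lt.1 hlt), zero_mul]
      _ ≤ _ := by
          refine (le_abs_self _).trans (hS _ ?_).le
          rw [Finset.disjoint_left]
          intro k hk hkS
          exact (Finset.mem_filter.1 hk).2.not_ge (hKS k hkS)
  have hhigh := h n T (v n) (hv n) K R t hK1 hR (ht.2.trans hT) ht
    fun τ hτ => hsob n τ ⟨hτ.1, hτ.2.trans ht.2⟩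
  calc _ ≤ ∑ k ∈ F ∩ freqs n, jb k ^ (2 * s) * ‖v n t k‖ ^ 2 := by
        refine (Finset.sum_subset Finset.inter_subset_left fun k hk hkn => ?_).symm.le
        rw [(hv n).supp t k fun hc => hkn (Finset.mem_inter.2 ⟨hk, hc⟩)]
        simp
    _ ≤ ∑ k ∈ freqs n with 2 * K ≤ |((k : ℤ) : ℝ)|, jb k ^ (2 * s) * ‖v n t k‖ ^ 2 := by
        refine Finset.sum_le_sum_of_subset_of_nonneg (fun k hk => ?_) fun k _ _ => hpos _ k
        rw [Finset.mem_inter] at hk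
        exact Finset.mem_filter.2 ⟨hk.2, hF k hk.1⟩
    _ ≤ C * (ε / (2 * C) + ε / (2 * C)) := hhigh.trans (by gcongr)
    _ = ε := by
        field_simp
        ring

lemma hnorm_lt_ofReal {s ε : ℝ} (hε : 0 < ε) {f : ℤ → ℂ}
    (h : sob s f ≤ ENNReal.ofReal (ε ^ 2 / 2)) : hnorm s f < ENNReal.ofReal ε := by
  have h1 : ENNReal.ofReal ε = (ENNReal.ofReal (ε ^ 2)) ^ (1 / 2 : ℝ) := by
    rw [ENNReal.ofReal_rpow_of_nonneg (sq_nonneg _) (by norm_num), ← Real.sqrt_eq_rpow,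
      Real.sqrt_sq hε.le]
  rw [hnorm_eq, h1]
  refine ENNReal.rpow_lt_rpow (h.trans_lt ?_) (by norm_num)
  rw [ENNReal.ofReal_lt_ofReal_iff (by positivity)]
  linarith [sq_pos_of_pos hε]

lemma exists_hnorm_sub_lt {s T B : ℝ} {w : ℝ → ℤ → ℂ}
    (htail : ∀ ε > (0 : ℝ), ∃ L : ℝ, ∀ t ∈ Set.Icc 0 T, ∀ F : Finset ℤ,
      (∀ k ∈ F, L ≤ |(k : ℝ)|) → ∑ k ∈ F, jb k ^ (2 * s) * ‖w t k‖ ^ 2 ≤ ε)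
    (hlip : ∀ t ∈ Set.Icc 0 T, ∀ t' ∈ Set.Icc 0 T, ∀ k : ℤ,
      ‖w t' k - w t k‖ ≤ B * |(k : ℝ)| * |t' - t|) {t ε : ℝ} (ht : t ∈ Set.Icc 0 T) (hε : 0 < ε) :
    ∃ δ > (0 : ℝ), ∀ t' ∈ Set.Icc 0 T, |t' - t| < δ →
      hnorm s (fun k => w t' k - w t k) < ENNReal.ofReal ε := by
  obtain ⟨L, hL⟩ := htail (ε ^ 2 / 16) (by positivity)
  have hj : ∀ k, 0 ≤ jb k ^ (2 * s) := fun k => Real.rpow_nonneg (jb_pos k).le _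
  set M : ℝ := ∑ k ∈ freqs ⌈L⌉₊, jb k ^ (2 * s) * (B * |(k : ℝ)|) ^ 2 with hM
  have hM0 : 0 ≤ M := Finset.sum_nonneg fun k _ => mul_nonneg (hj k) (sq_nonneg _)
  have hlim : Filter.Tendsto (fun δ : ℝ => M * δ ^ 2) (nhdsWithin 0 (Set.Ioi 0)) (nhds 0) := by
    have : Continuous fun δ : ℝ => M * δ ^ 2 := by fun_prop
    simpa using (this.tendsto 0).mono_left nhdsWithin_le_nhds
  obtain ⟨δ, hδM, hδ⟩ := ((hlim.eventually (gt_mem_nhds (by positivity : 0 < ε ^ 2 / 4))).and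
    self_mem_nhdsWithin).exists
  refine ⟨δ, hδ, fun t' ht' htt => hnorm_lt_ofReal hε ?_⟩
  rw [sob_le_iff (by positivity)]
  intro S
  have hlow : ∑ k ∈ S with ¬ L ≤ |((k : ℤ) : ℝ)|, jb k ^ (2 * s) * ‖w t' k - w t k‖ ^ 2 ≤
      ε ^ 2 / 4 := by
    calc _ ≤ ∑ k ∈ S with ¬ L ≤ |((k : ℤ) : ℝ)|, jb k ^ (2 * s) * (B * |(k : ℝ)|) ^ 2 * δ ^ 2 := by
          refine Finset.sum_le_sum fun k _ => ?_
          rw [mul_assoc, ← mul_pow]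
          refine mul_le_mul_of_nonneg_left ?_ (hj k)
          rw [← sq_abs (B * |(k : ℝ)| * δ)]
          refine pow_le_pow_left₀ (norm_nonneg _) ?_ 2
          rw [abs_mul, abs_of_pos hδ]
          refine (hlip t ht t' ht' k).trans ?_
          exact mul_le_mul (le_abs_self _) htt.le (abs_nonneg _) (abs_nonneg _)
      _ ≤ ∑ k ∈ freqs ⌈L⌉₊, jb k ^ (2 * s) * (B * |(k : ℝ)|) ^ 2 * δ ^ 2 := by
          refine Finset.sum_le_sum_of_subset_of_nonneg (fun k hk => ?_) fun k _ _ =>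
            mul_nonneg (mul_nonneg (hj k) (sq_nonneg _)) (sq_nonneg _)
          have h1 := (not_le.1 (Finset.mem_filter.1 hk).2).trans_le (Nat.le_ceil L)
          rw [mem_freqs]
          exact_mod_cast h1.le
      _ = M * δ ^ 2 := by rw [hM, Finset.sum_mul]
      _ ≤ _ := hδM.le
  have hhigh : ∑ k ∈ S with L ≤ |((k : ℤ) : ℝ)|, jb k ^ (2 * s) * ‖w t' k - w t k‖ ^ 2 ≤
      ε ^ 2 / 4 := by
    calc _ ≤ ∑ k ∈ S with L ≤ |((k : ℤ) : ℝ)|,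
          (2 * (jb k ^ (2 * s) * ‖w t' k‖ ^ 2) + 2 * (jb k ^ (2 * s) * ‖w t k‖ ^ 2)) := by
          refine Finset.sum_le_sum fun k _ => ?_
          have h1 : ‖w t' k - w t k‖ ^ 2 ≤ 2 * ‖w t' k‖ ^ 2 + 2 * ‖w t k‖ ^ 2 := by
            have := pow_le_pow_left₀ (norm_nonneg _) (norm_sub_le (w t' k) (w t k)) 2
            nlinarith [sq_nonneg (‖w t' k‖ - ‖w t k‖)]
          calc _ ≤ _ := mul_le_mul_of_nonneg_left h1 (hj k)
            _ = _ := by ring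
      _ ≤ 2 * (ε ^ 2 / 16) + 2 * (ε ^ 2 / 16) := by
          rw [Finset.sum_add_distrib, ← Finset.mul_sum, ← Finset.mul_sum]
          have hF : ∀ k ∈ S.filter fun k : ℤ => L ≤ |(k : ℝ)|, L ≤ |(k : ℝ)| := fun k hk =>
            (Finset.mem_filter.1 hk).2
          linarith [hL t ht _ hF, hL t' ht' _ hF]
      _ = _ := by ring
  rw [← Finset.sum_filter_add_sum_filter_not S fun k : ℤ => L ≤ |(k : ℝ)|]
  linarith

lemma IsGalerkin.norm_taylor_le {n : ℕ} {T : ℝ} {v : ℝ → ℤ → ℂ} (h : IsGalerkin n T v) {k : ℤ}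
    (hk : k ∈ freqs n) {t t' ε : ℝ} (ht : t ∈ Set.Icc 0 T) (ht' : t' ∈ Set.Icc 0 T) {z : ℂ}
    (hz : ∀ τ ∈ Set.uIcc t t', ‖Nonres (v τ) τ k + Res (v τ) k - z‖ ≤ ε) :
    ‖v t' k - v t k - (t' - t) • z‖ ≤ ε * |t' - t| := by
  have hsub : Set.uIcc t t' ⊆ Set.Icc 0 T := Set.uIcc_subset_Icc ht ht'
  have h1 := (convex_uIcc t t').norm_image_sub_le_of_norm_hasDerivWithin_le
    (f := fun τ => v τ k - τ • z) (f' := fun τ => Nonres (v τ) τ k + Res (v τ) k - z)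
    (fun τ hτ => by
      have := ((h.ode τ (hsub hτ) k hk).mono hsub).sub
        ((hasDerivWithinAt_id τ (Set.uIcc t t')).smul_const z)
      rw [one_smul] at this
      exact this) hz Set.left_mem_uIcc Set.right_mem_uIcc
  have h2 : v t' k - v t k - (t' - t) • z = v t' k - t' • z - (v t k - t • z) := by
    rw [sub_smul]
    ring
  rw [h2]
  exact h1

lemma hasDerivWithinAt_of_tendsto {l : Filter ℕ} [l.NeBot] (hl : l ≤ Filter.atTop) {s T R B : ℝ}
    (hs : 1 / 2 ≤ s) (hR : 1 ≤ R) {v : ℕ → ℝ → ℤ → ℂ} {w : ℝ → ℤ → ℂ}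
    (hv : ∀ n, IsGalerkin n T (v n))
    (hsob : ∀ n, ∀ t ∈ Set.Icc 0 T, sob s (v n t) ≤ ENNReal.ofReal (R ^ 2))
    (hlip : ∀ n, ∀ t ∈ Set.Icc 0 T, ∀ t' ∈ Set.Icc 0 T, ∀ k : ℤ,
      ‖v n t' k - v n t k‖ ≤ B * |(k : ℝ)| * |t' - t|)
    (hw : ∀ t ∈ Set.Icc 0 T, ∀ k, Filter.Tendsto (fun n => v n t k) l (nhds (w t k)))
    (hwsob : ∀ t ∈ Set.Icc 0 T, sob s (w t) ≤ ENNReal.ofReal (R ^ 2)) {t : ℝ}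
    (ht : t ∈ Set.Icc 0 T) (k : ℤ) :
    HasDerivWithinAt (fun τ => w τ k) (Nonres (w t) t k + Res (w t) k) (Set.Icc 0 T) t := by
  rw [hasDerivWithinAt_iff_isLittleO, Asymptotics.isLittleO_iff]
  intro ε hε
  obtain ⟨M, hM⟩ := exists_equicontinuity hs hR (half_pos hε) B k
  have hδ : ∀ᶠ t' in nhdsWithin t (Set.Icc 0 T), |M| * |t' - t| < ε / 2 := by
    have hc : Continuous fun t' : ℝ => |M| * |t' - t| := by fun_prop
    refine nhdsWithin_le_nhds ((hc.tendsto t).eventually (gt_mem_nhds ?_))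
    simpa using half_pos hε
  filter_upwards [hδ, self_mem_nhdsWithin] with t' hδ ht'
  rw [Real.norm_eq_abs]
  refine le_of_tendsto (((hw t' ht' k).sub (hw t ht k)).sub
    ((tendsto_field hs (by linarith) (fun n => hsob n t ht) (hwsob t ht) (hw t ht) t
      k).const_smul (t' - t))).norm ?_
  filter_upwards [hl (Filter.eventually_ge_atTop k.natAbs)] with n hn
  refine (hv n).norm_taylor_le (mem_freqs.2 (by rw [Int.abs_eq_natAbs]; exact_mod_cast hn)) ht ht'
    fun τ hτ => ?_
  have hτT := Set.uIcc_subset_Icc ht ht' hτ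
  refine (hM _ _ τ t (hsob n τ hτT) (hsob n t ht) fun j => hlip n t ht τ hτT j).trans ?_
  have h1 : |τ - t| ≤ |t' - t| := Set.abs_sub_left_of_mem_uIcc hτ
  have h2 : M * |τ - t| ≤ |M| * |t' - t| :=
    mul_le_mul (le_abs_self _) h1 (abs_nonneg _) (abs_nonneg _)
  linarith

/-- Local existence for periodic mKdV in `H^s`, `s ≥ 1/2`, with lifespan
`T ≥ c (1 + ‖v₀‖_{H^s})^{-β}`. -/
theorem local_existence (s : ℝ) (hs : 1 / 2 ≤ s) :
    ∃ c > (0 : ℝ), ∃ β > (0 : ℝ),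
      ∀ v₀ : ℤ → ℂ, hnorm s v₀ < ⊤ → (∀ k : ℤ, v₀ (-k) = starRingEnd ℂ (v₀ k)) →
        ∃ T : ℝ, c * (1 + (hnorm s v₀).toReal) ^ (-β) ≤ T ∧
          ∃ v : ℝ → ℤ → ℂ, IsSolution s T v ∧ v 0 = v₀ := by
  obtain ⟨c, hc, β, hβ, hap⟩ := exists_apriori hs
  obtain ⟨C, hC, hfield⟩ := exists_norm_field_le
  refine ⟨c, hc, β, hβ, fun v₀ hfin hreal => ?_⟩
  set ν := (hnorm s v₀).toReal with hν
  obtain ⟨T, R, hTeq, hT0, hT1, hR, hbound⟩ := hap ν ENNReal.toReal_nonneg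
  refine ⟨T, hTeq.le, ?_⟩
  have hR0 : 0 ≤ R := by linarith
  have hs0 : 0 ≤ s := by linarith
  have hsob0 : sob s v₀ = ENNReal.ofReal (ν ^ 2) := by
    rw [ENNReal.ofReal_pow ENNReal.toReal_nonneg, ENNReal.ofReal_toReal hfin.ne, hnorm_eq,
      ← ENNReal.rpow_natCast, ← ENNReal.rpow_mul]
    norm_num
  choose v hv hv0 using fun n => exists_isGalerkin n hT0.le hreal
  have hsob : ∀ n, ∀ t ∈ Set.Icc 0 T, sob s (v n t) ≤ ENNReal.ofReal (R ^ 2) := by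
    refine fun n => hbound n (v n) (hv n) ?_
    rw [Finset.sum_congr rfl fun k hk => by rw [hv0 n k hk]]
    exact (sob_le_iff (sq_nonneg ν) v₀).1 hsob0.le _
  have hlip : ∀ n, ∀ t ∈ Set.Icc 0 T, ∀ t' ∈ Set.Icc 0 T, ∀ k : ℤ,
      ‖v n t' k - v n t k‖ ≤ C * R ^ 3 * |(k : ℝ)| * |t' - t| := fun n t ht t' ht' k =>
    (hv n).norm_sub_le le_rfl
      (fun τ hτ => hfield s τ R (v n τ) hs hR0 ((hv n).real τ) (hsob n τ hτ) k) ht ht'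
  set l : Ultrafilter ℕ := Filter.hyperfilter ℕ with hl
  have hl' : (l : Filter ℕ) ≤ Filter.atTop := Nat.hyperfilter_le_atTop
  have hex : ∀ (t : ℝ) (k : ℤ), ∃ z : ℂ, t ∈ Set.Icc 0 T →
      Filter.Tendsto (fun n => v n t k) l (nhds z) := by
    intro t k
    by_cases ht : t ∈ Set.Icc 0 T
    · obtain ⟨z, -, hz⟩ := (isCompact_closedBall (0 : ℂ) R).ultrafilter_le_nhds
        (l.map fun n => v n t k) (Filter.le_principal_iff.2 (Filter.mem_map.2
          (Filter.univ_mem' fun n => mem_closedBall_zero_iff.2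
            (norm_le_of_sob_le hs0 hR0 (hsob n t ht) k))))
      exact ⟨z, fun _ => hz⟩
    · exact ⟨0, fun h => absurd h ht⟩
  choose w hw using hex
  have hw' : ∀ t ∈ Set.Icc 0 T, ∀ k, Filter.Tendsto (fun n => v n t k) l (nhds (w t k)) :=
    fun t ht k => hw t k ht
  have hsumlim : ∀ t ∈ Set.Icc 0 T, ∀ S : Finset ℤ, Filter.Tendsto
      (fun n => ∑ k ∈ S, jb k ^ (2 * s) * ‖v n t k‖ ^ 2) l
      (nhds (∑ k ∈ S, jb k ^ (2 * s) * ‖w t k‖ ^ 2)) := fun t ht S =>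
    tendsto_finsetSum _ fun k _ => ((hw' t ht k).norm.pow 2).const_mul _
  have hwsob : ∀ t ∈ Set.Icc 0 T, sob s (w t) ≤ ENNReal.ofReal (R ^ 2) := by
    intro t ht
    rw [sob_le_iff (sq_nonneg R)]
    exact fun S => le_of_tendsto' (hsumlim t ht S) fun n =>
      (sob_le_iff (sq_nonneg R) _).1 (hsob n t ht) S
  have hwlip : ∀ t ∈ Set.Icc 0 T, ∀ t' ∈ Set.Icc 0 T, ∀ k : ℤ,
      ‖w t' k - w t k‖ ≤ C * R ^ 3 * |(k : ℝ)| * |t' - t| := fun t ht t' ht' k =>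
    le_of_tendsto' ((hw' t' ht' k).sub (hw' t ht k)).norm fun n => hlip n t ht t' ht' k
  have hwtail : ∀ ε > (0 : ℝ), ∃ L : ℝ, ∀ t ∈ Set.Icc 0 T, ∀ F : Finset ℤ,
      (∀ k ∈ F, L ≤ |(k : ℝ)|) → ∑ k ∈ F, jb k ^ (2 * s) * ‖w t k‖ ^ 2 ≤ ε := by
    intro ε hε
    obtain ⟨L, hL⟩ := exists_uniform_tail hs (hsob0.trans_ne ENNReal.ofReal_ne_top) hT1 hR hv hv0
      hsob hε
    exact ⟨L, fun t ht F hF => le_of_tendsto' (hsumlim t ht F) fun n => hL n t ht F hF⟩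
  refine ⟨w, ⟨fun t ht => ?_, fun t ht ε hε => exists_hnorm_sub_lt hwtail hwlip ht hε,
    fun t ht k => summable_norm_ntermF hs hR0 (hwsob t ht) t k,
    fun t ht k => hasDerivWithinAt_of_tendsto hl' hs hR hv hsob hlip hw' hwsob ht k⟩, ?_⟩
  · rw [hnorm_eq]
    exact ENNReal.rpow_lt_top_of_nonneg (by norm_num)
      (ne_top_of_le_ne_top ENNReal.ofReal_ne_top (hwsob t ht))
  · funext k
    refine tendsto_nhds_unique (hw' 0 ⟨le_rfl, hT0.le⟩ k) (tendsto_const_nhds.congr' ?_)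
    filter_upwards [hl' (Filter.eventually_ge_atTop k.natAbs)] with n hn
    exact (hv0 n k (mem_freqs.2 (by rw [Int.abs_eq_natAbs]; exact_mod_cast hn))).symm
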